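/- The degree-15 resolvent polynomial f₁₅(x) = Π_{ω ∈ Ω}(x − ω), where Ω is the S₆-orbit of ρ₁ρ₂ + ρ₃ρ₄ + ρ₅ρ₆ in the roots ρ₁,…,ρ₆ of w⁶ + 4w⁵ − 64tw + 64t over ℂ(t), factors over ℂ(t) into an irreducible factor of degree 5 and one of degree 10; explicitly f₁₅(x) = (x⁵ − 2560tx² − 131072t² − 15360tx − 16384t)·(x¹⁰ − 1920tx⁷ + 45056t²x⁵ − 5120tx⁶ + 921600t²x⁴ − 32768tx⁵ − 10485760t³x² + 4915200t²x³ − 16777216t⁴ − 115343360t³x + 5242880t²x² − 213909504t³ + 83886080t²x + 268435456t²). -/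

import Mathlib

open Polynomial

section TriplePowerSums

variable {K : Type*} [CommRing K]

set_option maxHeartbeats 4000000 in
/-- The values for `k = 1, …, 15` of the sum of the `k`-th powers of the three matchings through
a fixed pair with sum `u` and product `v`. -/
structure TriplePowerSums (T : ℕ → K) (u v s : K) : Prop where
  psum_1 : T 1 = u ^ 2 + 4 * u + 2 * v
  psum_2 : T 2 = 7 * u ^ 4 + 24 * u ^ 3 - 20 * u ^ 2 * v - 16 * u ^ 2 - 40 * u * v + 10 * v ^ 2
    + 32 * v
  psum_3 : T 3 = 16 * u ^ 4 + 4 * u ^ 3 * v + 3 * u ^ 2 * v ^ 2 + 64 * u ^ 3 - 48 * u ^ 2 * v +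
    16 * u * v ^ 2 + 4 * v ^ 3 - 192 * u * v + 4 * u * s + 64 * v ^ 2 + 42 * s
  psum_4 : T 4 = 64 * u ^ 3 * v + 23 * u ^ 3 * s - 128 * u ^ 2 * v ^ 2 + 96 * u * v ^ 3 + 36 * v
    ^ 4 + 256 * u ^ 2 * v + 73 * u ^ 2 * s - 640 * u * v ^ 2 - 41 * u * v * s + 512 * v ^ 3 - 4
    * u * s - 256 * v ^ 2 + 22 * v * s + 352 * s
  psum_5 : T 5 = 235 * u ^ 4 * s - 5 * u ^ 3 * v * s + 900 * u ^ 3 * s - 690 * u ^ 2 * v * s +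
    320 * u * v ^ 3 + 20 * u * v ^ 2 * s + 80 * v ^ 4 - 80 * u ^ 2 * s - 1400 * u * v * s + 1280
    * v ^ 3 + 430 * v ^ 2 * s + 320 * u * s + 1440 * v * s + 21 * s ^ 2 + 768 * s
  psum_6 : T 6 = 2240 * u ^ 4 * s - 260 * u ^ 3 * v * s + 225 * u ^ 2 * v ^ 2 * s + 95 * u * v ^
    3 * s + 8960 * u ^ 3 * s - 8160 * u ^ 2 * v * s + 82 * u ^ 2 * s ^ 2 + 2540 * u * v ^ 2 * s
    + 610 * v ^ 3 * s + 256 * u ^ 2 * s - 18240 * u * v * s + 278 * u * s ^ 2 + 8800 * v ^ 2 * s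
    - 26 * v * s ^ 2 + 1024 * u * s + 5632 * v * s + 1040 * s ^ 2
  psum_7 : T 7 = 99 * u ^ 4 * s ^ 2 + 6912 * u ^ 4 * s + 1600 * u ^ 3 * v * s + 1453 * u ^ 3 * s
    ^ 2 - 1840 * u ^ 2 * v ^ 2 * s - 305 * u ^ 2 * v * s ^ 2 + 5760 * u * v ^ 3 * s + 1750 * v ^
    4 * s + 26624 * u ^ 3 * s - 14080 * u ^ 2 * v * s + 3623 * u ^ 2 * s ^ 2 - 3200 * u * v ^ 2
    * s - 2510 * u * v * s ^ 2 + 27040 * v ^ 3 * s + 230 * v ^ 2 * s ^ 2 - 4096 * u ^ 2 * s -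
    51200 * u * v * s + 1080 * u * s ^ 2 + 30720 * v ^ 2 * s + 504 * v * s ^ 2 + 8192 * v * s +
    17600 * s ^ 2
  psum_8 : T 8 = 8227 * u ^ 4 * s ^ 2 - 182 * u ^ 3 * v * s ^ 2 + 316 * u ^ 2 * v ^ 2 * s ^ 2 +
    4096 * u ^ 4 * s + 6144 * u ^ 3 * v * s + 40008 * u ^ 3 * s ^ 2 - 8192 * u ^ 2 * v ^ 2 * s -
    24356 * u ^ 2 * v * s ^ 2 + 62720 * u * v ^ 3 * s + 3152 * u * v ^ 2 * s ^ 2 + 16640 * v ^ 4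
    * s - 52 * v ^ 3 * s ^ 2 + 16384 * u ^ 3 * s + 8192 * u ^ 2 * v * s + 28240 * u ^ 2 * s ^ 2
    - 36864 * u * v ^ 2 * s - 63144 * u * v * s ^ 2 + 303 * u * s ^ 3 + 262144 * v ^ 3 * s +
    20938 * v ^ 2 * s ^ 2 - 49152 * u * v * s + 7424 * u * s ^ 2 + 16384 * v ^ 2 * s + 46240 * v
    * s ^ 2 + 1584 * s ^ 3 + 97792 * s ^ 2
  psum_9 : T 9 = 134640 * u ^ 4 * s ^ 2 - 17452 * u ^ 3 * v * s ^ 2 + 436 * u ^ 3 * s ^ 3 +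
    13199 * u ^ 2 * v ^ 2 * s ^ 2 + 9232 * u * v ^ 3 * s ^ 2 + 982 * v ^ 4 * s ^ 2 + 16384 * u ^
    3 * v * s + 566208 * u ^ 3 * s ^ 2 - 73728 * u ^ 2 * v ^ 2 * s - 480368 * u ^ 2 * v * s ^ 2
    + 6381 * u ^ 2 * s ^ 3 + 193536 * u * v ^ 3 * s + 149760 * u * v ^ 2 * s ^ 2 - 927 * u * v *
    s ^ 3 + 54016 * v ^ 4 * s + 45324 * v ^ 3 * s ^ 2 + 65536 * u ^ 2 * v * s + 115968 * u ^ 2 *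
    s ^ 2 - 327680 * u * v ^ 2 * s - 1043776 * u * v * s ^ 2 + 15282 * u * s ^ 3 + 847872 * v ^
    3 * s + 516608 * v ^ 2 * s ^ 2 - 2316 * v * s ^ 3 + 45056 * u * s ^ 2 - 65536 * v ^ 2 * s +
    460032 * v * s ^ 2 + 44874 * s ^ 3 + 192512 * s ^ 2
  psum_10 : T 10 = 8665 * u ^ 4 * s ^ 3 + 55 * u ^ 3 * v * s ^ 3 + 830720 * u ^ 4 * s ^ 2 -
    66560 * u ^ 3 * v * s ^ 2 + 79475 * u ^ 3 * s ^ 3 + 78000 * u ^ 2 * v ^ 2 * s ^ 2 - 26360 *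
    u ^ 2 * v * s ^ 3 + 317280 * u * v ^ 3 * s ^ 2 - 220 * u * v ^ 2 * s ^ 3 + 79520 * v ^ 4 * s
    ^ 2 + 3276800 * u ^ 3 * s ^ 2 - 2746880 * u ^ 2 * v * s ^ 2 + 189505 * u ^ 2 * s ^ 3 +
    163840 * u * v ^ 3 * s + 1178240 * u * v ^ 2 * s ^ 2 - 136275 * u * v * s ^ 3 + 40960 * v ^
    4 * s + 1409920 * v ^ 3 * s ^ 2 + 18570 * v ^ 2 * s ^ 3 - 143360 * u ^ 2 * s ^ 2 - 6118400 *
    u * v * s ^ 2 + 156980 * u * s ^ 3 + 655360 * v ^ 3 * s + 4245760 * v ^ 2 * s ^ 2 + 22410 *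
    v * s ^ 3 + 1147 * s ^ 4 + 163840 * u * s ^ 2 + 1863680 * v * s ^ 2 + 812352 * s ^ 3 +
    196608 * s ^ 2
  psum_11 : T 11 = 378935 * u ^ 4 * s ^ 3 - 12315 * u ^ 3 * v * s ^ 3 + 23125 * u ^ 2 * v ^ 2 *
    s ^ 3 + 1705 * u * v ^ 3 * s ^ 3 + 2170880 * u ^ 4 * s ^ 2 - 30720 * u ^ 3 * v * s ^ 2 +
    2100940 * u ^ 3 * s ^ 3 + 288000 * u ^ 2 * v ^ 2 * s ^ 2 - 1158790 * u ^ 2 * v * s ^ 3 +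
    1849 * u ^ 2 * s ^ 4 + 4699840 * u * v ^ 3 * s ^ 2 + 223760 * u * v ^ 2 * s ^ 3 + 1194000 *
    v ^ 4 * s ^ 2 + 8390 * v ^ 3 * s ^ 3 + 8683520 * u ^ 3 * s ^ 2 - 6942720 * u ^ 2 * v * s ^ 2
    + 2364384 * u ^ 2 * s ^ 3 + 4398080 * u * v ^ 2 * s ^ 2 - 3447560 * u * v * s ^ 3 + 24946 *
    u * s ^ 4 + 19480320 * v ^ 3 * s ^ 2 + 1155950 * v ^ 2 * s ^ 3 + 288 * v * s ^ 4 + 65536 * u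
    ^ 2 * s ^ 2 - 17940480 * u * v * s ^ 2 + 819136 * u * s ^ 3 + 15667200 * v ^ 2 * s ^ 2 +
    1633568 * v * s ^ 3 + 95535 * s ^ 4 + 262144 * u * s ^ 2 + 2752512 * v * s ^ 2 + 7009280 * s
    ^ 3
  psum_12 : T 12 = 4418 * u ^ 4 * s ^ 4 + 7082768 * u ^ 4 * s ^ 3 - 814900 * u ^ 3 * v * s ^ 3 +
    57541 * u ^ 3 * s ^ 4 + 739065 * u ^ 2 * v ^ 2 * s ^ 3 - 13165 * u ^ 2 * v * s ^ 4 + 578065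
    * u * v ^ 3 * s ^ 3 + 86650 * v ^ 4 * s ^ 3 + 3080192 * u ^ 4 * s ^ 2 + 1638400 * u ^ 3 * v
    * s ^ 2 + 32344256 * u ^ 3 * s ^ 3 - 3194880 * u ^ 2 * v ^ 2 * s ^ 2 - 24588000 * u ^ 2 * v
    * s ^ 3 + 368031 * u ^ 2 * s ^ 4 + 29649920 * u * v ^ 3 * s ^ 2 + 7966100 * u * v ^ 2 * s ^
    3 - 109880 * u * v * s ^ 4 + 7801600 * v ^ 4 * s ^ 2 + 2635110 * v ^ 3 * s ^ 3 + 8480 * v ^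
    2 * s ^ 4 + 12058624 * u ^ 3 * s ^ 2 - 2621440 * u ^ 2 * v * s ^ 2 + 15762176 * u ^ 2 * s ^
    3 - 9830400 * u * v ^ 2 * s ^ 2 - 57191360 * u * v * s ^ 3 + 843870 * u * s ^ 4 + 123514880
    * v ^ 3 * s ^ 2 + 27795200 * v ^ 2 * s ^ 3 - 99262 * v * s ^ 4 - 1048576 * u ^ 2 * s ^ 2 -
    23592960 * u * v * s ^ 2 + 2319360 * u * s ^ 3 + 21626880 * v ^ 2 * s ^ 2 + 25550848 * v * s
    ^ 3 + 2552700 * s ^ 4 + 2097152 * v * s ^ 2 + 29081600 * s ^ 3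
  psum_13 : T 13 = 567594 * u ^ 4 * s ^ 4 + 3456 * u ^ 3 * v * s ^ 4 + 7527 * u ^ 2 * v ^ 2 * s
    ^ 4 + 64641024 * u ^ 4 * s ^ 3 - 8331904 * u ^ 3 * v * s ^ 3 + 4404301 * u ^ 3 * s ^ 4 +
    8793952 * u ^ 2 * v ^ 2 * s ^ 3 - 1714907 * u ^ 2 * v * s ^ 4 + 17900080 * u * v ^ 3 * s ^ 3
    + 47544 * u * v ^ 2 * s ^ 4 + 4030410 * v ^ 4 * s ^ 3 + 576 * v ^ 3 * s ^ 4 + 1048576 * u ^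
    4 * s ^ 2 + 2883584 * u ^ 3 * v * s ^ 2 + 267959296 * u ^ 3 * s ^ 3 - 7667712 * u ^ 2 * v ^
    2 * s ^ 2 - 226487552 * u ^ 2 * v * s ^ 3 + 10440335 * u ^ 2 * s ^ 4 + 91095040 * u * v ^ 3
    * s ^ 2 + 101477184 * u * v ^ 2 * s ^ 3 - 7567308 * u * v * s ^ 4 + 7671 * u * s ^ 5 +
    23470080 * v ^ 4 * s ^ 2 + 77613056 * v ^ 3 * s ^ 3 + 1290296 * v ^ 2 * s ^ 4 + 4194304 * u
    ^ 3 * s ^ 2 + 7340032 * u ^ 2 * v * s ^ 2 + 39137280 * u ^ 2 * s ^ 3 - 33030144 * u * v ^ 2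
    * s ^ 2 - 487216128 * u * v * s ^ 3 + 11691136 * u * s ^ 4 + 373161984 * v ^ 3 * s ^ 2 +
    319750656 * v ^ 2 * s ^ 3 + 1127460 * v * s ^ 4 + 114868 * s ^ 5 - 12582912 * u * v * s ^ 2
    + 10502144 * u * s ^ 3 + 4194304 * v ^ 2 * s ^ 2 + 177172480 * v * s ^ 3 + 42760768 * s ^ 4
    + 68616192 * s ^ 3
  psum_14 : T 14 = 20579335 * u ^ 4 * s ^ 4 - 832664 * u ^ 3 * v * s ^ 4 + 17227 * u ^ 3 * s ^ 5
    + 1308333 * u ^ 2 * v ^ 2 * s ^ 4 + 301494 * u * v ^ 3 * s ^ 4 + 33234 * v ^ 4 * s ^ 4 +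
    304455680 * u ^ 4 * s ^ 3 - 42753024 * u ^ 3 * v * s ^ 3 + 117792912 * u ^ 3 * s ^ 4 +
    65659648 * u ^ 2 * v ^ 2 * s ^ 3 - 64452096 * u ^ 2 * v * s ^ 4 + 248632 * u ^ 2 * s ^ 5 +
    292433024 * u * v ^ 3 * s ^ 3 + 13088400 * u * v ^ 2 * s ^ 4 - 33844 * u * v * s ^ 5 +
    70870784 * v ^ 4 * s ^ 3 + 1525748 * v ^ 3 * s ^ 4 + 4194304 * u ^ 3 * v * s ^ 2 +
    1232928768 * u ^ 3 * s ^ 3 - 29360128 * u ^ 2 * v ^ 2 * s ^ 2 - 1095663616 * u ^ 2 * v * s ^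
    3 + 152575392 * u ^ 2 * s ^ 4 + 132120576 * u * v ^ 3 * s ^ 2 + 704578560 * u * v ^ 2 * s ^
    3 - 198201544 * u * v * s ^ 4 + 1517219 * u * s ^ 5 + 35127296 * v ^ 4 * s ^ 2 + 1209676288
    * v ^ 3 * s ^ 3 + 65491306 * v ^ 2 * s ^ 4 - 10902 * v * s ^ 5 + 16777216 * u ^ 2 * v * s ^
    2 + 67698688 * u ^ 2 * s ^ 3 - 125829120 * u * v ^ 2 * s ^ 2 - 2364686336 * u * v * s ^ 3 +
    87013504 * u * s ^ 4 + 557842432 * v ^ 3 * s ^ 2 + 1986871296 * v ^ 2 * s ^ 3 + 72087008 * v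
    * s ^ 4 + 5758988 * s ^ 5 + 36438016 * u * s ^ 3 - 16777216 * v ^ 2 * s ^ 2 + 591265792 * v
    * s ^ 3 + 447961088 * s ^ 4 + 75497472 * s ^ 3
  psum_15 : T 15 = 517420 * u ^ 4 * s ^ 5 - 610 * u ^ 3 * v * s ^ 5 + 387449120 * u ^ 4 * s ^ 4
    - 38645260 * u ^ 3 * v * s ^ 4 + 4792925 * u ^ 3 * s ^ 5 + 40640375 * u ^ 2 * v ^ 2 * s ^ 4
    - 1545880 * u ^ 2 * v * s ^ 5 + 33307590 * u * v ^ 3 * s ^ 4 + 2440 * u * v ^ 2 * s ^ 5 +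
    5725910 * v ^ 4 * s ^ 4 + 829358080 * u ^ 4 * s ^ 3 - 43991040 * u ^ 3 * v * s ^ 3 +
    1884740800 * u ^ 3 * s ^ 4 + 134656000 * u ^ 2 * v ^ 2 * s ^ 3 - 1317472080 * u ^ 2 * v * s
    ^ 4 + 20669490 * u ^ 2 * s ^ 5 + 2594135040 * u * v ^ 3 * s ^ 3 + 427930040 * u * v ^ 2 * s
    ^ 4 - 8698600 * u * v * s ^ 5 + 656431360 * v ^ 4 * s ^ 3 + 148959160 * v ^ 3 * s ^ 4 +
    1011760 * v ^ 2 * s ^ 5 + 3289907200 * u ^ 3 * s ^ 3 - 2670264320 * u ^ 2 * v * s ^ 3 +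
    1348285440 * u ^ 2 * s ^ 4 + 62914560 * u * v ^ 3 * s ^ 2 + 2023260160 * u * v ^ 2 * s ^ 3 -
    3285956800 * u * v * s ^ 4 + 47264790 * u * s ^ 5 + 15728640 * v ^ 4 * s ^ 2 + 10635202560 *
    v ^ 3 * s ^ 3 + 1534371360 * v ^ 2 * s ^ 4 - 3014070 * v * s ^ 5 + 31404 * s ^ 6 - 94371840
    * u ^ 2 * s ^ 3 - 6356992000 * u * v * s ^ 3 + 343920640 * u * s ^ 4 + 251658240 * v ^ 3 * s
    ^ 2 + 6739722240 * v ^ 2 * s ^ 3 + 1339649280 * v * s ^ 4 + 150841246 * s ^ 5 + 62914560 * u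
    * s ^ 3 + 1148190720 * v * s ^ 3 + 2741485568 * s ^ 4 + 50331648 * s ^ 3

theorem pair_relations {u v s : K}
    (h₀ : u ^ 5 + 4 * u ^ 4 - 4 * u ^ 3 * v - 12 * u ^ 2 * v + 3 * u * v ^ 2 + 4 * v ^ 2 - s = 0)
    (h₁ : u ^ 4 * v + 4 * u ^ 3 * v - 3 * u ^ 2 * v ^ 2 - 8 * u * v ^ 2 + v ^ 3 - s = 0) :
    u ^ 3 * v ^ 2 + 4 * u ^ 2 * v ^ 2 - 2 * u * v ^ 3 - 4 * v ^ 3 - u * s + v * s = 0 ∧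
    u ^ 2 * v ^ 3 + 4 * u * v ^ 3 - v ^ 4 - u ^ 2 * s + u * v * s + v * s = 0 ∧
    u * v ^ 4 - u ^ 3 * s + u ^ 2 * v * s + 4 * v ^ 4 + 2 * u * v * s - v ^ 2 * s = 0 ∧
    -u ^ 4 * s + u ^ 3 * v * s + v ^ 5 + 3 * u ^ 2 * v * s - 2 * u * v ^ 2 * s - v ^ 2 * s = 0 := by
  have g2 : u ^ 3 * v ^ 2 + 4 * u ^ 2 * v ^ 2 - 2 * u * v ^ 3 - 4 * v ^ 3 - u * s + v * s = 0 := by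
    linear_combination u * h₁ - v * h₀
  have g3 : u ^ 2 * v ^ 3 + 4 * u * v ^ 3 - v ^ 4 - u ^ 2 * s + u * v * s + v * s = 0 := by
    linear_combination u * g2 - v * h₁
  have g4 : u * v ^ 4 - u ^ 3 * s + u ^ 2 * v * s + 4 * v ^ 4 + 2 * u * v * s - v ^ 2 * s = 0 := by
    linear_combination u * g3 - v * g2
  have g5 : -u ^ 4 * s + u ^ 3 * v * s + v ^ 5 + 3 * u ^ 2 * v * s - 2 * u * v ^ 2 * s - v ^ 2 * s = 0 := by
    linear_combination u * g4 - v * g3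
  exact ⟨g2, g3, g4, g5⟩

set_option maxHeartbeats 2000000 in
/-- Closed forms of a sequence satisfying the linear recurrence of the power sums of the three
matchings through a fixed pair with sum `u` and product `v`. -/
theorem triple_recurrence_values {u v s : K} (T : ℕ → K)
    (h₀ : u ^ 5 + 4 * u ^ 4 - 4 * u ^ 3 * v - 12 * u ^ 2 * v + 3 * u * v ^ 2 + 4 * v ^ 2 - s = 0)
    (h₁ : u ^ 4 * v + 4 * u ^ 3 * v - 3 * u ^ 2 * v ^ 2 - 8 * u * v ^ 2 + v ^ 3 - s = 0)
    (T0 : T 0 = 3) (T1 : T 1 = u ^ 2 + 4 * u + 2 * v)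
    (T2 : T 2 = 7 * u ^ 4 + 24 * u ^ 3 - 20 * u ^ 2 * v - 16 * u ^ 2 - 40 * u * v + 10 * v ^ 2 + 32 * v)
    (hT : ∀ k, T (k + 3) =
      (u ^ 2 + 4 * u + 2 * v) * T (k + 2)
      - (-3 * u ^ 4 - 8 * u ^ 3 + 12 * u ^ 2 * v + 16 * u ^ 2 + 28 * u * v - 3 * v ^ 2 - 16 * v) * T (k + 1)
      + (16 * u ^ 4 + 64 * u ^ 3 - 48 * u ^ 2 * v + 4 * u * v ^ 2 + 2 * v ^ 3 - 128 * u * v - 2 * u * s + 32 * v ^ 2 - 6 * s) * T k) :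
    TriplePowerSums T u v s := by
  have g0 := h₀
  have g1 := h₁
  obtain ⟨g2, g3, g4, g5⟩ := pair_relations h₀ h₁
  have T3 : T 3 = 16 * u ^ 4 + 4 * u ^ 3 * v + 3 * u ^ 2 * v ^ 2 + 64 * u ^ 3 - 48 * u ^ 2 * v +
    16 * u * v ^ 2 + 4 * v ^ 3 - 192 * u * v + 4 * u * s + 64 * v ^ 2 + 42 * s := by
    rw [hT 0, T2, T1, T0]
    linear_combination (10 * u + 32) * g0 + (28) * g1
  have T4 : T 4 = 64 * u ^ 3 * v + 23 * u ^ 3 * s - 128 * u ^ 2 * v ^ 2 + 96 * u * v ^ 3 + 36 *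
    v ^ 4 + 256 * u ^ 2 * v + 73 * u ^ 2 * s - 640 * u * v ^ 2 - 41 * u * v * s + 512 * v ^ 3 -
    4 * u * s - 256 * v ^ 2 + 22 * v * s + 352 * s := by
    rw [hT 1, T3, T2, T1]
    linear_combination (21 * u ^ 3 + 44 * u ^ 2 - 60 * u * v - 112 * u - 92 * v + 192) * g0 +
      (-9 * v + 160) * g1 + (-36) * g2 + (-15) * g3
  have T5 : T 5 = 235 * u ^ 4 * s - 5 * u ^ 3 * v * s + 900 * u ^ 3 * s - 690 * u ^ 2 * v * s +
    320 * u * v ^ 3 + 20 * u * v ^ 2 * s + 80 * v ^ 4 - 80 * u ^ 2 * s - 1400 * u * v * s + 1280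
    * v ^ 3 + 430 * v ^ 2 * s + 320 * u * s + 1440 * v * s + 21 * s ^ 2 + 768 * s := by
    rw [hT 2, T4, T3, T2]
    linear_combination (160 * u ^ 3 + 12 * u ^ 2 * v + 9 * u * v ^ 2 + 512 * u ^ 2 - 368 * u * v
      + 64 * v ^ 2 - 512 * u - 704 * v + 21 * s) * g0 + (26 * v ^ 2 + 32 * v + 768) * g1 + (56 *
      v - 576) * g2 + (8 * v - 352) * g3 + (292) * g4 + (86) * g5
  have T6 : T 6 = 2240 * u ^ 4 * s - 260 * u ^ 3 * v * s + 225 * u ^ 2 * v ^ 2 * s + 95 * u * v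
    ^ 3 * s + 8960 * u ^ 3 * s - 8160 * u ^ 2 * v * s + 82 * u ^ 2 * s ^ 2 + 2540 * u * v ^ 2 *
    s + 610 * v ^ 3 * s + 256 * u ^ 2 * s - 18240 * u * v * s + 278 * u * s ^ 2 + 8800 * v ^ 2 *
    s - 26 * v * s ^ 2 + 1024 * u * s + 5632 * v * s + 1040 * s ^ 2 := by
    rw [hT 3, T5, T4, T3]
    linear_combination (256 * u ^ 3 + 256 * u ^ 2 * v + 69 * u ^ 2 * s - 336 * u * v ^ 2 + 288 *
      v ^ 3 + 1024 * u ^ 2 + 362 * u * s - 1024 * v ^ 2 - 128 * v * s - 3072 * v + 628 * s) * g0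
      + (108 * v ^ 3 + 1312 * v ^ 2 + 2304 * v + 664 * s) * g1 + (-124 * v ^ 2 - 640 * v - 60 *
      s - 2048) * g2 + (-102 * v ^ 2 - 944 * v + 2816) * g3 + (-512 * v + 3520) * g4 + (-94 * v
      + 672) * g5
  have T7 : T 7 = 99 * u ^ 4 * s ^ 2 + 6912 * u ^ 4 * s + 1600 * u ^ 3 * v * s + 1453 * u ^ 3 *
    s ^ 2 - 1840 * u ^ 2 * v ^ 2 * s - 305 * u ^ 2 * v * s ^ 2 + 5760 * u * v ^ 3 * s + 1750 * v
    ^ 4 * s + 26624 * u ^ 3 * s - 14080 * u ^ 2 * v * s + 3623 * u ^ 2 * s ^ 2 - 3200 * u * v ^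
    2 * s - 2510 * u * v * s ^ 2 + 27040 * v ^ 3 * s + 230 * v ^ 2 * s ^ 2 - 4096 * u ^ 2 * s -
    51200 * u * v * s + 1080 * u * s ^ 2 + 30720 * v ^ 2 * s + 504 * v * s ^ 2 + 8192 * v * s +
    17600 * s ^ 2 := by
    rw [hT 4, T6, T5, T4]
    linear_combination (705 * u ^ 3 * s - 15 * u ^ 2 * v * s + 1024 * u ^ 2 * v + 2128 * u ^ 2 *
      s - 2048 * u * v ^ 2 - 2050 * u * v * s + 2496 * v ^ 3 + 60 * v ^ 2 * s + 4096 * u * v -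
      432 * u * s - 9216 * v ^ 2 - 3868 * v * s + 10176 * s) * g0 + (816 * v ^ 3 + 8960 * v ^ 2
      + 229 * v * s + 9536 * s) * g1 + (832 * v ^ 2 + 99 * v * s - 12288 * v - 1968 * s) * g2 +
      (-112 * v ^ 2 - 8960 * v + 109 * s + 4096) * g3 + (336 * v ^ 2 - 896 * v + 258 * s + 1024)
      * g4 + (72 * v ^ 2 + 144 * v) * g5
  have T8 : T 8 = 8227 * u ^ 4 * s ^ 2 - 182 * u ^ 3 * v * s ^ 2 + 316 * u ^ 2 * v ^ 2 * s ^ 2 +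
    4096 * u ^ 4 * s + 6144 * u ^ 3 * v * s + 40008 * u ^ 3 * s ^ 2 - 8192 * u ^ 2 * v ^ 2 * s -
    24356 * u ^ 2 * v * s ^ 2 + 62720 * u * v ^ 3 * s + 3152 * u * v ^ 2 * s ^ 2 + 16640 * v ^ 4
    * s - 52 * v ^ 3 * s ^ 2 + 16384 * u ^ 3 * s + 8192 * u ^ 2 * v * s + 28240 * u ^ 2 * s ^ 2
    - 36864 * u * v ^ 2 * s - 63144 * u * v * s ^ 2 + 303 * u * s ^ 3 + 262144 * v ^ 3 * s +
    20938 * v ^ 2 * s ^ 2 - 49152 * u * v * s + 7424 * u * s ^ 2 + 16384 * v ^ 2 * s + 46240 * v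
    * s ^ 2 + 1584 * s ^ 3 + 97792 * s ^ 2 := by
    rw [hT 5, T7, T6, T5]
    linear_combination (10480 * u ^ 3 * s - 860 * u ^ 2 * v * s + 675 * u * v ^ 2 * s + 285 * v
      ^ 3 * s + 32320 * u ^ 2 * s - 30720 * u * v * s + 345 * u * s ^ 2 + 5120 * v ^ 3 + 7900 *
      v ^ 2 * s - 29440 * u * s - 46400 * v * s + 1489 * s ^ 2 + 33792 * s) * g0 + (1280 * v ^ 3
      + 1900 * v ^ 2 * s + 20480 * v ^ 2 + 10160 * v * s + 221 * s ^ 2 + 68608 * s) * g1 + (-10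
      * v ^ 2 * s + 5120 * v ^ 2 + 4000 * v * s - 30080 * s) * g2 + (1280 * v ^ 2 - 1720 * v * s
      - 9200 * s) * g3 + (960 * v ^ 2 - 550 * v * s + 5120 * v + 13980 * s) * g4 + (160 * v ^ 2
      + 1280 * v + 3590 * s) * g5
  have T9 : T 9 = 134640 * u ^ 4 * s ^ 2 - 17452 * u ^ 3 * v * s ^ 2 + 436 * u ^ 3 * s ^ 3 +
    13199 * u ^ 2 * v ^ 2 * s ^ 2 + 9232 * u * v ^ 3 * s ^ 2 + 982 * v ^ 4 * s ^ 2 + 16384 * u ^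
    3 * v * s + 566208 * u ^ 3 * s ^ 2 - 73728 * u ^ 2 * v ^ 2 * s - 480368 * u ^ 2 * v * s ^ 2
    + 6381 * u ^ 2 * s ^ 3 + 193536 * u * v ^ 3 * s + 149760 * u * v ^ 2 * s ^ 2 - 927 * u * v *
    s ^ 3 + 54016 * v ^ 4 * s + 45324 * v ^ 3 * s ^ 2 + 65536 * u ^ 2 * v * s + 115968 * u ^ 2 *
    s ^ 2 - 327680 * u * v ^ 2 * s - 1043776 * u * v * s ^ 2 + 15282 * u * s ^ 3 + 847872 * v ^
    3 * s + 516608 * v ^ 2 * s ^ 2 - 2316 * v * s ^ 3 + 45056 * u * s ^ 2 - 65536 * v ^ 2 * s +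
    460032 * v * s ^ 2 + 44874 * s ^ 3 + 192512 * s ^ 2 := by
    rw [hT 6, T8, T7, T6]
    linear_combination (297 * u ^ 3 * s ^ 2 + 56576 * u ^ 3 * s + 640 * u ^ 2 * v * s + 3963 * u
      ^ 2 * s ^ 2 - 1920 * u * v ^ 2 * s - 915 * u * v * s ^ 2 + 18800 * v ^ 3 * s + 195584 * u
      ^ 2 * s - 143360 * u * v * s + 14596 * u * s ^ 2 + 43200 * v ^ 2 * s - 7284 * v * s ^ 2 -
      110592 * u * s - 294912 * v * s + 28724 * s ^ 2 + 49152 * s) * g0 + (5250 * v ^ 3 * s +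
      74880 * v ^ 2 * s + 412 * v * s ^ 2 + 160256 * v * s + 22390 * s ^ 2 + 143360 * s) * g1 +
      (-5100 * v ^ 2 * s - 4800 * v * s - 1902 * s ^ 2 - 229376 * s) * g2 + (-4420 * v ^ 2 * s -
      66640 * v * s + 670 * s ^ 2 + 78080 * s) * g3 + (190 * v ^ 2 * s - 28080 * v * s + 253440
      * s) * g4 + (-3960 * v * s + 54720 * s) * g5
  have T10 : T 10 = 8665 * u ^ 4 * s ^ 3 + 55 * u ^ 3 * v * s ^ 3 + 830720 * u ^ 4 * s ^ 2 -
    66560 * u ^ 3 * v * s ^ 2 + 79475 * u ^ 3 * s ^ 3 + 78000 * u ^ 2 * v ^ 2 * s ^ 2 - 26360 *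
    u ^ 2 * v * s ^ 3 + 317280 * u * v ^ 3 * s ^ 2 - 220 * u * v ^ 2 * s ^ 3 + 79520 * v ^ 4 * s
    ^ 2 + 3276800 * u ^ 3 * s ^ 2 - 2746880 * u ^ 2 * v * s ^ 2 + 189505 * u ^ 2 * s ^ 3 +
    163840 * u * v ^ 3 * s + 1178240 * u * v ^ 2 * s ^ 2 - 136275 * u * v * s ^ 3 + 40960 * v ^
    4 * s + 1409920 * v ^ 3 * s ^ 2 + 18570 * v ^ 2 * s ^ 3 - 143360 * u ^ 2 * s ^ 2 - 6118400 *
    u * v * s ^ 2 + 156980 * u * s ^ 3 + 655360 * v ^ 3 * s + 4245760 * v ^ 2 * s ^ 2 + 22410 *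
    v * s ^ 3 + 1147 * s ^ 4 + 163840 * u * s ^ 2 + 1863680 * v * s ^ 2 + 812352 * s ^ 3 +
    196608 * s ^ 2 := by
    rw [hT 7, T9, T8, T7]
    linear_combination (26265 * u ^ 3 * s ^ 2 - 546 * u ^ 2 * v * s ^ 2 + 948 * u * v ^ 2 * s ^
      2 + 122880 * u ^ 3 * s + 44032 * u ^ 2 * v * s + 110364 * u ^ 2 * s ^ 2 - 54016 * u * v ^
      2 * s - 75636 * u * v * s ^ 2 + 280320 * v ^ 3 * s + 8588 * v ^ 2 * s ^ 2 + 458752 * u ^ 2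
      * s - 114688 * u * v * s + 117296 * u * s ^ 2 - 75776 * v ^ 2 * s - 192188 * v * s ^ 2 +
      1147 * s ^ 3 - 131072 * u * s - 589824 * v * s + 478976 * s ^ 2) * g0 + (77920 * v ^ 3 * s
      + 42 * v ^ 2 * s ^ 2 + 958976 * v ^ 2 * s + 26779 * v * s ^ 2 + 643072 * v * s + 438976 *
      s ^ 2 + 196608 * s) * g1 + (21440 * v ^ 2 * s + 6982 * v * s ^ 2 - 774144 * v * s - 98132
      * s ^ 2 - 475136 * s) * g2 + (-30560 * v ^ 2 * s - 774 * v * s ^ 2 - 956672 * v * s +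
      22381 * s ^ 2 + 565248 * s) * g3 + (18520 * v ^ 2 * s - 268160 * v * s + 20544 * s ^ 2 +
      1006592 * s) * g4 + (3500 * v ^ 2 * s - 22560 * v * s + 1452 * s ^ 2 + 208896 * s) * g5
  have T11 : T 11 = 378935 * u ^ 4 * s ^ 3 - 12315 * u ^ 3 * v * s ^ 3 + 23125 * u ^ 2 * v ^ 2 *
    s ^ 3 + 1705 * u * v ^ 3 * s ^ 3 + 2170880 * u ^ 4 * s ^ 2 - 30720 * u ^ 3 * v * s ^ 2 +
    2100940 * u ^ 3 * s ^ 3 + 288000 * u ^ 2 * v ^ 2 * s ^ 2 - 1158790 * u ^ 2 * v * s ^ 3 +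
    1849 * u ^ 2 * s ^ 4 + 4699840 * u * v ^ 3 * s ^ 2 + 223760 * u * v ^ 2 * s ^ 3 + 1194000 *
    v ^ 4 * s ^ 2 + 8390 * v ^ 3 * s ^ 3 + 8683520 * u ^ 3 * s ^ 2 - 6942720 * u ^ 2 * v * s ^ 2
    + 2364384 * u ^ 2 * s ^ 3 + 4398080 * u * v ^ 2 * s ^ 2 - 3447560 * u * v * s ^ 3 + 24946 *
    u * s ^ 4 + 19480320 * v ^ 3 * s ^ 2 + 1155950 * v ^ 2 * s ^ 3 + 288 * v * s ^ 4 + 65536 * u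
    ^ 2 * s ^ 2 - 17940480 * u * v * s ^ 2 + 819136 * u * s ^ 3 + 15667200 * v ^ 2 * s ^ 2 +
    1633568 * v * s ^ 3 + 95535 * s ^ 4 + 262144 * u * s ^ 2 + 2752512 * v * s ^ 2 + 7009280 * s
    ^ 3 := by
    rw [hT 8, T10, T9, T8]
    linear_combination (535552 * u ^ 3 * s ^ 2 - 55268 * u ^ 2 * v * s ^ 2 + 1308 * u ^ 2 * s ^
      3 + 44653 * u * v ^ 2 * s ^ 2 + 27696 * v ^ 3 * s ^ 2 + 65536 * u ^ 3 * s + 147456 * u ^ 2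
      * v * s + 1800192 * u ^ 2 * s ^ 2 - 352256 * u * v ^ 2 * s - 1629360 * u * v * s ^ 2 +
      26064 * u * s ^ 3 + 1584128 * v ^ 3 * s + 476912 * v ^ 2 * s ^ 2 - 2726 * v * s ^ 3 +
      262144 * u ^ 2 * s + 327680 * u * v * s - 634368 * u * s ^ 2 - 1163264 * v ^ 2 * s -
      2723712 * v * s ^ 2 + 88191 * s ^ 3 - 786432 * v * s + 3058688 * s ^ 2) * g0 + (2946 * v ^
      3 * s ^ 2 + 428288 * v ^ 3 * s + 118994 * v ^ 2 * s ^ 2 + 5865472 * v ^ 2 * s + 762448 * v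
      * s ^ 2 + 16848 * s ^ 3 + 1572864 * v * s + 4537344 * s ^ 2) * g1 + (-3028 * v ^ 2 * s ^ 2
      + 766976 * v ^ 2 * s + 194840 * v * s ^ 2 - 720 * s ^ 3 - 3031040 * v * s - 1555776 * s ^
      2 - 524288 * s) * g2 + (-2314 * v ^ 2 * s ^ 2 + 72448 * v ^ 2 * s - 154988 * v * s ^ 2 -
      3047424 * v * s + 26192 * s ^ 2 + 2031616 * s) * g3 + (192000 * v ^ 2 * s - 50024 * v * s
      ^ 2 - 161792 * v * s + 731060 * s ^ 2 + 2048000 * s) * g4 + (33280 * v ^ 2 * s - 2418 * v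
      * s ^ 2 + 94976 * v * s + 154154 * s ^ 2 + 376832 * s) * g5
  have T12 : T 12 = 4418 * u ^ 4 * s ^ 4 + 7082768 * u ^ 4 * s ^ 3 - 814900 * u ^ 3 * v * s ^ 3
    + 57541 * u ^ 3 * s ^ 4 + 739065 * u ^ 2 * v ^ 2 * s ^ 3 - 13165 * u ^ 2 * v * s ^ 4 +
    578065 * u * v ^ 3 * s ^ 3 + 86650 * v ^ 4 * s ^ 3 + 3080192 * u ^ 4 * s ^ 2 + 1638400 * u ^
    3 * v * s ^ 2 + 32344256 * u ^ 3 * s ^ 3 - 3194880 * u ^ 2 * v ^ 2 * s ^ 2 - 24588000 * u ^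
    2 * v * s ^ 3 + 368031 * u ^ 2 * s ^ 4 + 29649920 * u * v ^ 3 * s ^ 2 + 7966100 * u * v ^ 2
    * s ^ 3 - 109880 * u * v * s ^ 4 + 7801600 * v ^ 4 * s ^ 2 + 2635110 * v ^ 3 * s ^ 3 + 8480
    * v ^ 2 * s ^ 4 + 12058624 * u ^ 3 * s ^ 2 - 2621440 * u ^ 2 * v * s ^ 2 + 15762176 * u ^ 2
    * s ^ 3 - 9830400 * u * v ^ 2 * s ^ 2 - 57191360 * u * v * s ^ 3 + 843870 * u * s ^ 4 +
    123514880 * v ^ 3 * s ^ 2 + 27795200 * v ^ 2 * s ^ 3 - 99262 * v * s ^ 4 - 1048576 * u ^ 2 *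
    s ^ 2 - 23592960 * u * v * s ^ 2 + 2319360 * u * s ^ 3 + 21626880 * v ^ 2 * s ^ 2 + 25550848
    * v * s ^ 3 + 2552700 * s ^ 4 + 2097152 * v * s ^ 2 + 29081600 * s ^ 3 := by
    rw [hT 9, T11, T10, T9]
    linear_combination (25995 * u ^ 3 * s ^ 3 + 165 * u ^ 2 * v * s ^ 3 + 4646400 * u ^ 3 * s ^
      2 - 478912 * u ^ 2 * v * s ^ 2 + 210741 * u ^ 2 * s ^ 3 + 445184 * u * v ^ 2 * s ^ 2 -
      79300 * u * v * s ^ 3 + 1099552 * v ^ 3 * s ^ 2 - 660 * v ^ 2 * s ^ 3 + 262144 * u ^ 2 * v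
      * s + 15566848 * u ^ 2 * s ^ 2 - 1179648 * u * v ^ 2 * s - 13506048 * u * v * s ^ 2 +
      731646 * u * s ^ 3 + 3588096 * v ^ 3 * s + 5878208 * v ^ 2 * s ^ 2 - 392876 * v * s ^ 3 +
      1048576 * u * v * s - 9510912 * u * s ^ 2 - 4980736 * v ^ 2 * s - 21685248 * v * s ^ 2 +
      1789092 * s ^ 3 + 10469376 * s ^ 2) * g0 + (254272 * v ^ 3 * s ^ 2 + 987136 * v ^ 3 * s +
      4096480 * v ^ 2 * s ^ 2 + 30993 * v * s ^ 3 + 13762560 * v ^ 2 * s + 11121664 * v * s ^ 2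
      + 1032852 * s ^ 3 + 19767296 * s ^ 2) * g1 + (-152476 * v ^ 2 * s ^ 2 + 283 * v * s ^ 3 +
      2670592 * v ^ 2 * s + 853248 * v * s ^ 2 - 88476 * s ^ 3 - 7077888 * v * s - 15551488 * s
      ^ 2) * g2 + (-175234 * v ^ 2 * s ^ 2 + 503808 * v ^ 2 * s - 4185360 * v * s ^ 2 + 49173 *
      s ^ 3 - 4915200 * v * s + 3693056 * s ^ 2 + 1048576 * s) * g3 + (22392 * v ^ 2 * s ^ 2 +
      603136 * v ^ 2 * s - 1492672 * v * s ^ 2 + 5406 * s ^ 3 + 1818624 * v * s + 14191296 * s ^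
      2 + 262144 * s) * g4 + (1964 * v ^ 2 * s ^ 2 + 108032 * v ^ 2 * s - 158442 * v * s ^ 2 +
      651264 * v * s + 3054400 * s ^ 2) * g5
  have T13 : T 13 = 567594 * u ^ 4 * s ^ 4 + 3456 * u ^ 3 * v * s ^ 4 + 7527 * u ^ 2 * v ^ 2 * s
    ^ 4 + 64641024 * u ^ 4 * s ^ 3 - 8331904 * u ^ 3 * v * s ^ 3 + 4404301 * u ^ 3 * s ^ 4 +
    8793952 * u ^ 2 * v ^ 2 * s ^ 3 - 1714907 * u ^ 2 * v * s ^ 4 + 17900080 * u * v ^ 3 * s ^ 3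
    + 47544 * u * v ^ 2 * s ^ 4 + 4030410 * v ^ 4 * s ^ 3 + 576 * v ^ 3 * s ^ 4 + 1048576 * u ^
    4 * s ^ 2 + 2883584 * u ^ 3 * v * s ^ 2 + 267959296 * u ^ 3 * s ^ 3 - 7667712 * u ^ 2 * v ^
    2 * s ^ 2 - 226487552 * u ^ 2 * v * s ^ 3 + 10440335 * u ^ 2 * s ^ 4 + 91095040 * u * v ^ 3
    * s ^ 2 + 101477184 * u * v ^ 2 * s ^ 3 - 7567308 * u * v * s ^ 4 + 7671 * u * s ^ 5 +
    23470080 * v ^ 4 * s ^ 2 + 77613056 * v ^ 3 * s ^ 3 + 1290296 * v ^ 2 * s ^ 4 + 4194304 * u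
    ^ 3 * s ^ 2 + 7340032 * u ^ 2 * v * s ^ 2 + 39137280 * u ^ 2 * s ^ 3 - 33030144 * u * v ^ 2
    * s ^ 2 - 487216128 * u * v * s ^ 3 + 11691136 * u * s ^ 4 + 373161984 * v ^ 3 * s ^ 2 +
    319750656 * v ^ 2 * s ^ 3 + 1127460 * v * s ^ 4 + 114868 * s ^ 5 - 12582912 * u * v * s ^ 2
    + 10502144 * u * s ^ 3 + 4194304 * v ^ 2 * s ^ 2 + 177172480 * v * s ^ 3 + 42760768 * s ^ 4
    + 68616192 * s ^ 3 := by
    rw [hT 10, T12, T11, T10]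
    linear_combination (1275445 * u ^ 3 * s ^ 3 - 36065 * u ^ 2 * v * s ^ 3 + 69375 * u * v ^ 2
      * s ^ 3 + 5115 * v ^ 3 * s ^ 3 + 19804160 * u ^ 3 * s ^ 2 - 1157120 * u ^ 2 * v * s ^ 2 +
      6058680 * u ^ 2 * s ^ 3 + 2112000 * u * v ^ 2 * s ^ 2 - 3710230 * u * v * s ^ 3 + 9965 * u
      * s ^ 4 + 19176000 * v ^ 3 * s ^ 2 + 610800 * v ^ 2 * s ^ 3 + 69795840 * u ^ 2 * s ^ 2 -
      51363840 * u * v * s ^ 2 + 8804240 * u * s ^ 3 + 2621440 * v ^ 3 * s + 33152000 * v ^ 2 *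
      s ^ 2 - 10462700 * v * s ^ 3 + 107653 * s ^ 4 - 33751040 * u * s ^ 2 - 87244800 * v * s ^
      2 + 26194368 * s ^ 3 + 15204352 * s ^ 2) * g0 + (4854320 * v ^ 3 * s ^ 2 + 35900 * v ^ 2 *
      s ^ 3 + 655360 * v ^ 3 * s + 64843520 * v ^ 2 * s ^ 2 + 1766365 * v * s ^ 3 + 14097 * s ^
      4 + 10485760 * v ^ 2 * s + 77189120 * v * s ^ 2 + 21440512 * s ^ 3 + 54591488 * s ^ 2) *
      g1 + (110 * v ^ 2 * s ^ 3 + 479360 * v ^ 2 * s ^ 2 + 395425 * v * s ^ 3 + 2621440 * v ^ 2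
      * s - 31539200 * v * s ^ 2 - 4757320 * s ^ 3 - 70696960 * s ^ 2) * g2 + (-2156880 * v ^ 2
      * s ^ 2 - 85480 * v * s ^ 3 + 655360 * v ^ 2 * s - 65981440 * v * s ^ 2 + 1433025 * s ^ 3
      + 42598400 * s ^ 2) * g3 + (952640 * v ^ 2 * s ^ 2 - 10450 * v * s ^ 3 + 491520 * v ^ 2 *
      s - 20469120 * v * s ^ 2 + 1230170 * s ^ 3 + 2621440 * v * s + 107202560 * s ^ 2) * g4 +
      (159040 * v ^ 2 * s ^ 2 + 81920 * v ^ 2 * s - 1875280 * v * s ^ 2 + 136010 * s ^ 3 +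
      655360 * v * s + 23022080 * s ^ 2) * g5
  have T14 : T 14 = 20579335 * u ^ 4 * s ^ 4 - 832664 * u ^ 3 * v * s ^ 4 + 17227 * u ^ 3 * s ^
    5 + 1308333 * u ^ 2 * v ^ 2 * s ^ 4 + 301494 * u * v ^ 3 * s ^ 4 + 33234 * v ^ 4 * s ^ 4 +
    304455680 * u ^ 4 * s ^ 3 - 42753024 * u ^ 3 * v * s ^ 3 + 117792912 * u ^ 3 * s ^ 4 +
    65659648 * u ^ 2 * v ^ 2 * s ^ 3 - 64452096 * u ^ 2 * v * s ^ 4 + 248632 * u ^ 2 * s ^ 5 +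
    292433024 * u * v ^ 3 * s ^ 3 + 13088400 * u * v ^ 2 * s ^ 4 - 33844 * u * v * s ^ 5 +
    70870784 * v ^ 4 * s ^ 3 + 1525748 * v ^ 3 * s ^ 4 + 4194304 * u ^ 3 * v * s ^ 2 +
    1232928768 * u ^ 3 * s ^ 3 - 29360128 * u ^ 2 * v ^ 2 * s ^ 2 - 1095663616 * u ^ 2 * v * s ^
    3 + 152575392 * u ^ 2 * s ^ 4 + 132120576 * u * v ^ 3 * s ^ 2 + 704578560 * u * v ^ 2 * s ^
    3 - 198201544 * u * v * s ^ 4 + 1517219 * u * s ^ 5 + 35127296 * v ^ 4 * s ^ 2 + 1209676288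
    * v ^ 3 * s ^ 3 + 65491306 * v ^ 2 * s ^ 4 - 10902 * v * s ^ 5 + 16777216 * u ^ 2 * v * s ^
    2 + 67698688 * u ^ 2 * s ^ 3 - 125829120 * u * v ^ 2 * s ^ 2 - 2364686336 * u * v * s ^ 3 +
    87013504 * u * s ^ 4 + 557842432 * v ^ 3 * s ^ 2 + 1986871296 * v ^ 2 * s ^ 3 + 72087008 * v
    * s ^ 4 + 5758988 * s ^ 5 + 36438016 * u * s ^ 3 - 16777216 * v ^ 2 * s ^ 2 + 591265792 * v
    * s ^ 3 + 447961088 * s ^ 4 + 75497472 * s ^ 3 := by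
    rw [hT 11, T13, T12, T11]
    linear_combination (13254 * u ^ 3 * s ^ 4 + 27311264 * u ^ 3 * s ^ 3 - 2641740 * u ^ 2 * v *
      s ^ 3 + 154951 * u ^ 2 * s ^ 4 + 2587195 * u * v ^ 2 * s ^ 3 - 39495 * u * v * s ^ 4 +
      1761475 * v ^ 3 * s ^ 3 + 43974656 * u ^ 3 * s ^ 2 + 4423680 * u ^ 2 * v * s ^ 2 +
      102316736 * u ^ 2 * s ^ 3 - 4976640 * u * v ^ 2 * s ^ 2 - 82982080 * u * v * s ^ 3 +
      1471107 * u * s ^ 4 + 164147200 * v ^ 3 * s ^ 2 + 25840900 * v ^ 2 * s ^ 3 - 308868 * v *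
      s ^ 4 + 162791424 * u ^ 2 * s ^ 2 - 90767360 * u * v * s ^ 2 + 20380672 * u * s ^ 3 +
      61849600 * v ^ 2 * s ^ 2 - 159762048 * v * s ^ 3 + 5105053 * s ^ 4 - 49283072 * u * s ^ 2
      - 230162432 * v * s ^ 2 + 220633088 * s ^ 3 + 12582912 * s ^ 2) * g0 + (259950 * v ^ 3 * s
      ^ 3 + 42508800 * v ^ 3 * s ^ 2 + 6805920 * v ^ 2 * s ^ 3 + 6459 * v * s ^ 4 + 572456960 *
      v ^ 2 * s ^ 2 + 47209984 * v * s ^ 3 + 1227145 * s ^ 4 + 308740096 * v * s ^ 2 + 269383680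
      * s ^ 3 + 62914560 * s ^ 2) * g1 + (-251450 * v ^ 2 * s ^ 3 + 45081600 * v ^ 2 * s ^ 2 +
      9732800 * v * s ^ 3 - 72614 * s ^ 4 - 310886400 * v * s ^ 2 - 85476864 * s ^ 3 - 187170816
      * s ^ 2) * g2 + (-206880 * v ^ 2 * s ^ 3 - 4029440 * v ^ 2 * s ^ 2 - 9449760 * v * s ^ 3 +
      9115 * s ^ 4 - 425287680 * v * s ^ 2 + 17401120 * s ^ 3 + 260505600 * s ^ 2) * g3 + (3410
      * v ^ 2 * s ^ 3 + 14175680 * v ^ 2 * s ^ 2 - 3036570 * v * s ^ 3 - 91304960 * v * s ^ 2 +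
      41329660 * s ^ 3 + 429998080 * s ^ 2) * g4 + (2388000 * v ^ 2 * s ^ 2 - 203740 * v * s ^ 3
      - 2667520 * v * s ^ 2 + 7771830 * s ^ 3 + 88227840 * s ^ 2) * g5
  have T15 : T 15 = 517420 * u ^ 4 * s ^ 5 - 610 * u ^ 3 * v * s ^ 5 + 387449120 * u ^ 4 * s ^ 4
    - 38645260 * u ^ 3 * v * s ^ 4 + 4792925 * u ^ 3 * s ^ 5 + 40640375 * u ^ 2 * v ^ 2 * s ^ 4
    - 1545880 * u ^ 2 * v * s ^ 5 + 33307590 * u * v ^ 3 * s ^ 4 + 2440 * u * v ^ 2 * s ^ 5 +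
    5725910 * v ^ 4 * s ^ 4 + 829358080 * u ^ 4 * s ^ 3 - 43991040 * u ^ 3 * v * s ^ 3 +
    1884740800 * u ^ 3 * s ^ 4 + 134656000 * u ^ 2 * v ^ 2 * s ^ 3 - 1317472080 * u ^ 2 * v * s
    ^ 4 + 20669490 * u ^ 2 * s ^ 5 + 2594135040 * u * v ^ 3 * s ^ 3 + 427930040 * u * v ^ 2 * s
    ^ 4 - 8698600 * u * v * s ^ 5 + 656431360 * v ^ 4 * s ^ 3 + 148959160 * v ^ 3 * s ^ 4 +
    1011760 * v ^ 2 * s ^ 5 + 3289907200 * u ^ 3 * s ^ 3 - 2670264320 * u ^ 2 * v * s ^ 3 +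
    1348285440 * u ^ 2 * s ^ 4 + 62914560 * u * v ^ 3 * s ^ 2 + 2023260160 * u * v ^ 2 * s ^ 3 -
    3285956800 * u * v * s ^ 4 + 47264790 * u * s ^ 5 + 15728640 * v ^ 4 * s ^ 2 + 10635202560 *
    v ^ 3 * s ^ 3 + 1534371360 * v ^ 2 * s ^ 4 - 3014070 * v * s ^ 5 + 31404 * s ^ 6 - 94371840
    * u ^ 2 * s ^ 3 - 6356992000 * u * v * s ^ 3 + 343920640 * u * s ^ 4 + 251658240 * v ^ 3 * s
    ^ 2 + 6739722240 * v ^ 2 * s ^ 3 + 1339649280 * v * s ^ 4 + 150841246 * s ^ 5 + 62914560 * u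
    * s ^ 3 + 1148190720 * v * s ^ 3 + 2741485568 * s ^ 4 + 50331648 * s ^ 3 := by
    rw [hT 12, T14, T13, T12]
    linear_combination (1773470 * u ^ 3 * s ^ 4 + 10368 * u ^ 2 * v * s ^ 4 + 22581 * u * v ^ 2
      * s ^ 4 + 307247360 * u ^ 3 * s ^ 3 - 38034112 * u ^ 2 * v * s ^ 3 + 11863183 * u ^ 2 * s
      ^ 4 + 38206896 * u * v ^ 2 * s ^ 3 - 5298497 * u * v * s ^ 4 + 62949280 * v ^ 3 * s ^ 3 +
      130196 * v ^ 2 * s ^ 4 + 52428800 * u ^ 3 * s ^ 2 + 34865152 * u ^ 2 * v * s ^ 2 +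
      1062821888 * u ^ 2 * s ^ 3 - 74121216 * u * v ^ 2 * s ^ 2 - 926218752 * u * v * s ^ 3 +
      40171632 * u * s ^ 4 + 747683840 * v ^ 3 * s ^ 2 + 412006016 * v ^ 2 * s ^ 3 - 22053136 *
      v * s ^ 4 + 31404 * s ^ 5 + 201326592 * u ^ 2 * s ^ 2 + 17825792 * u * v * s ^ 2 -
      397774848 * u * s ^ 3 - 187170816 * v ^ 2 * s ^ 2 - 1513133056 * v * s ^ 3 + 110441364 * s
      ^ 4 - 33554432 * u * s ^ 2 - 255852544 * v * s ^ 2 + 1138835456 * s ^ 3) * g0 + (13477630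
      * v ^ 3 * s ^ 3 + 10564 * v ^ 2 * s ^ 4 + 195235840 * v ^ 3 * s ^ 2 + 226131584 * v ^ 2 *
      s ^ 3 + 2025713 * v * s ^ 4 + 2692939776 * v ^ 2 * s ^ 2 + 720755968 * v * s ^ 3 +
      55716082 * s ^ 4 + 536870912 * v * s ^ 2 + 1777139712 * s ^ 3 + 50331648 * s ^ 2) * g1 +
      (-5546140 * v ^ 2 * s ^ 3 + 142704 * v * s ^ 4 + 371015680 * v ^ 2 * s ^ 2 + 70396864 * v
      * s ^ 3 - 5774174 * s ^ 4 - 1383071744 * v * s ^ 2 - 978069504 * s ^ 3 - 205520896 * s ^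
      2) * g2 + (-8300840 * v ^ 2 * s ^ 3 - 13478 * v * s ^ 4 + 41799680 * v ^ 2 * s ^ 2 -
      252581968 * v * s ^ 3 + 2712257 * s ^ 4 - 1473380352 * v * s ^ 2 + 272832512 * s ^ 3 +
      574619648 * s ^ 2) * g3 + (1502730 * v ^ 2 * s ^ 3 + 90506240 * v ^ 2 * s ^ 2 - 84187440 *
      v * s ^ 3 + 792808 * s ^ 4 - 65617920 * v * s ^ 2 + 787367488 * s ^ 3 + 758382592 * s ^ 2)
      * g4 + (173300 * v ^ 2 * s ^ 3 + 15603200 * v ^ 2 * s ^ 2 - 7655140 * v * s ^ 3 + 61114 *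
      s ^ 4 + 51630080 * v * s ^ 2 + 163035744 * s ^ 3 + 150470656 * s ^ 2) * g5
  exact ⟨T1, T2, T3, T4, T5, T6, T7, T8, T9, T10, T11, T12, T13, T14, T15⟩

theorem coeff_relations {p q a b c d s : K}
    (h : (X ^ 6 + 4 * X ^ 5 - C s * X + C s : K[X]) =
      (X - C p) * (X - C q) * (X - C a) * (X - C b) * (X - C c) * (X - C d)) :
    (a + b + c + d) + (p + q) = -4 ∧
    (a * b + a * c + a * d + b * c + b * d + c * d) + (p + q) * (a + b + c + d) + p * q = 0 ∧
    (a * b * c + a * b * d + a * c * d + b * c * d)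
      + (p + q) * (a * b + a * c + a * d + b * c + b * d + c * d)
      + p * q * (a + b + c + d) = 0 ∧
    a * b * c * d + (p + q) * (a * b * c + a * b * d + a * c * d + b * c * d)
      + p * q * (a * b + a * c + a * d + b * c + b * d + c * d) = 0 ∧
    (p + q) * (a * b * c * d) + p * q * (a * b * c + a * b * d + a * c * d + b * c * d) = s ∧
    p * q * (a * b * c * d) = s := by
  have key : (C s : K[X]) + C (-s) * X + C 0 * X ^ 2 + C 0 * X ^ 3 + C 0 * X ^ 4 + C 4 * X ^ 5
      + X ^ 6 =
      C (p * q * (a * b * c * d))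
      + C (-((p + q) * (a * b * c * d)
        + p * q * (a * b * c + a * b * d + a * c * d + b * c * d))) * X
      + C (a * b * c * d + (p + q) * (a * b * c + a * b * d + a * c * d + b * c * d)
        + p * q * (a * b + a * c + a * d + b * c + b * d + c * d)) * X ^ 2
      + C (-((a * b * c + a * b * d + a * c * d + b * c * d)
        + (p + q) * (a * b + a * c + a * d + b * c + b * d + c * d)
        + p * q * (a + b + c + d))) * X ^ 3
      + C ((a * b + a * c + a * d + b * c + b * d + c * d) + (p + q) * (a + b + c + d)
        + p * q) * X ^ 4
      + C (-((a + b + c + d) + (p + q))) * X ^ 5 + X ^ 6 := by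
    have h4 : (C 4 : K[X]) = 4 := rfl
    simp only [C_add, C_mul, C_neg, C_0, h4]
    linear_combination h
  have hc (n : ℕ) := congrArg (coeff · n) key
  have c0 := hc 0
  have c1 := hc 1
  have c2 := hc 2
  have c3 := hc 3
  have c4 := hc 4
  have c5 := hc 5
  simp only [coeff_add, coeff_C_mul, coeff_X_pow, coeff_X, coeff_C] at c0 c1 c2 c3 c4 c5
  norm_num at c0 c1 c2 c3 c4 c5
  refine ⟨?_, ?_, ?_, ?_, ?_, ?_⟩
  · linear_combination c5
  · linear_combination -c4
  · linear_combination c3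
  · linear_combination -c2
  · linear_combination c1
  · linear_combination -c0

theorem matching_triple_power_sums {p q a b c d s : K}
    (h : (X ^ 6 + 4 * X ^ 5 - C s * X + C s : K[X]) =
      (X - C p) * (X - C q) * (X - C a) * (X - C b) * (X - C c) * (X - C d))
    {x y z : K} (hx : x = p * q + a * b + c * d) (hy : y = p * q + a * c + b * d)
    (hz : z = p * q + a * d + b * c) {u v : K} (hu : u = p + q) (hv : v = p * q) :
    TriplePowerSums (fun k ↦ x ^ k + y ^ k + z ^ k) u v s := by
  obtain ⟨e1, e2, e3, e4, e5, e6⟩ := coeff_relations h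
  rw [← hu, ← hv] at e2 e3 e4 e5
  rw [← hu] at e1
  rw [← hv] at e6 hx hy hz
  obtain ⟨q1, hq1⟩ : ∃ q1, q1 = a + b + c + d := ⟨_, rfl⟩
  obtain ⟨q2, hq2⟩ : ∃ q2, q2 = a * b + a * c + a * d + b * c + b * d + c * d := ⟨_, rfl⟩
  obtain ⟨q3, hq3⟩ : ∃ q3, q3 = a * b * c + a * b * d + a * c * d + b * c * d := ⟨_, rfl⟩
  obtain ⟨q4, hq4⟩ : ∃ q4, q4 = a * b * c * d := ⟨_, rfl⟩
  have hE1 : x + y + z = 3 * v + q2 := by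
    rw [hx, hy, hz, hq2]; ring
  have hE2 : x * y + x * z + y * z = 3 * v ^ 2 + 2 * v * q2 + q1 * q3 - 4 * q4 := by
    rw [hx, hy, hz, hq1, hq2, hq3, hq4]; ring
  have hE3 : x * y * z = v ^ 3 + v ^ 2 * q2 + v * (q1 * q3 - 4 * q4)
      + q3 ^ 2 + q1 ^ 2 * q4 - 4 * q2 * q4 := by
    rw [hx, hy, hz, hq1, hq2, hq3, hq4]; ring
  rw [← hq1] at e1 e2 e3
  rw [← hq2] at e2 e3 e4
  rw [← hq3] at e3 e4 e5
  rw [← hq4] at e4 e5 e6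
  have r1 : q1 = -4 - u := by linear_combination e1
  have r2 : q2 = -v - u * q1 := by linear_combination e2
  have r3 : q3 = -(u * q2 + v * q1) := by linear_combination e3
  have r4 : q4 = -(u * q3 + v * q2) := by linear_combination e4
  clear hq1 hq2 hq3 hq4 e1 e2 e3 e4 hx hy hz hu hv h
  subst r4 r3 r2 r1

  have h₀ : u ^ 5 + 4 * u ^ 4 - 4 * u ^ 3 * v - 12 * u ^ 2 * v + 3 * u * v ^ 2 + 4 * v ^ 2 - s = 0 := by linear_combination e5
  have h₁ : u ^ 4 * v + 4 * u ^ 3 * v - 3 * u ^ 2 * v ^ 2 - 8 * u * v ^ 2 + v ^ 3 - s = 0 := by linear_combination e6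
  obtain ⟨g2, g3, g4, g5⟩ := pair_relations h₀ h₁
  have g0 := h₀
  have g1 := h₁
  have k1 : x + y + z = u ^ 2 + 4 * u + 2 * v := by linear_combination hE1
  have k2 : x * y + x * z + y * z = -3 * u ^ 4 - 8 * u ^ 3 + 12 * u ^ 2 * v + 16 * u ^ 2 + 28 *
    u * v - 3 * v ^ 2 - 16 * v := by
    linear_combination hE2
  have k3 : x * y * z = 16 * u ^ 4 + 64 * u ^ 3 - 48 * u ^ 2 * v + 4 * u * v ^ 2 + 2 * v ^ 3 -
    128 * u * v - 2 * u * s + 32 * v ^ 2 - 6 * s := by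
    linear_combination hE3 + (-2 * u - 4) * g0 + (-2) * g1
  have k4 : x ^ 2 + y ^ 2 + z ^ 2 = 7 * u ^ 4 + 24 * u ^ 3 - 20 * u ^ 2 * v - 16 * u ^ 2 - 40 * u * v + 10 * v ^ 2 + 32 * v := by
    linear_combination (x + y + z + u ^ 2 + 4 * u + 2 * v) * k1 - 2 * k2
  refine triple_recurrence_values (fun k ↦ x ^ k + y ^ k + z ^ k) h₀ h₁ (by norm_num)
    (by simpa using k1) k4 fun k ↦ ?_
  simp only [← k1, ← k2, ← k3]
  ring

end TriplePowerSums

section Matchings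

variable {K : Type*} [CommRing K]

/-- The fifteen values `ρ_a ρ_b + ρ_c ρ_d + ρ_e ρ_f`, one for each perfect matching. -/
def matchingValue (ρ : Fin 6 → K) : Fin 15 → K :=
  ![ρ 0 * ρ 1 + ρ 2 * ρ 3 + ρ 4 * ρ 5,
    ρ 0 * ρ 1 + ρ 2 * ρ 4 + ρ 3 * ρ 5,
    ρ 0 * ρ 1 + ρ 2 * ρ 5 + ρ 3 * ρ 4,
    ρ 0 * ρ 2 + ρ 1 * ρ 3 + ρ 4 * ρ 5,
    ρ 0 * ρ 2 + ρ 1 * ρ 4 + ρ 3 * ρ 5,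
    ρ 0 * ρ 2 + ρ 1 * ρ 5 + ρ 3 * ρ 4,
    ρ 0 * ρ 3 + ρ 1 * ρ 2 + ρ 4 * ρ 5,
    ρ 0 * ρ 3 + ρ 1 * ρ 4 + ρ 2 * ρ 5,
    ρ 0 * ρ 3 + ρ 1 * ρ 5 + ρ 2 * ρ 4,
    ρ 0 * ρ 4 + ρ 1 * ρ 2 + ρ 3 * ρ 5,
    ρ 0 * ρ 4 + ρ 1 * ρ 3 + ρ 2 * ρ 5,
    ρ 0 * ρ 4 + ρ 1 * ρ 5 + ρ 2 * ρ 3,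
    ρ 0 * ρ 5 + ρ 1 * ρ 2 + ρ 3 * ρ 4,
    ρ 0 * ρ 5 + ρ 1 * ρ 3 + ρ 2 * ρ 4,
    ρ 0 * ρ 5 + ρ 1 * ρ 4 + ρ 2 * ρ 3]

/-- The sums `ρ_a + ρ_b` over the fifteen pairs. -/
def pairSum (ρ : Fin 6 → K) : Fin 15 → K :=
  ![ρ 0 + ρ 1, ρ 0 + ρ 2, ρ 0 + ρ 3, ρ 0 + ρ 4, ρ 0 + ρ 5, ρ 1 + ρ 2, ρ 1 + ρ 3, ρ 1 + ρ 4, ρ 1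
    + ρ 5, ρ 2 + ρ 3, ρ 2 + ρ 4, ρ 2 + ρ 5, ρ 3 + ρ 4, ρ 3 + ρ 5, ρ 4 + ρ 5]

/-- The products `ρ_a ρ_b` over the fifteen pairs. -/
def pairProd (ρ : Fin 6 → K) : Fin 15 → K :=
  ![ρ 0 * ρ 1, ρ 0 * ρ 2, ρ 0 * ρ 3, ρ 0 * ρ 4, ρ 0 * ρ 5, ρ 1 * ρ 2, ρ 1 * ρ 3, ρ 1 * ρ 4, ρ 1
    * ρ 5, ρ 2 * ρ 3, ρ 2 * ρ 4, ρ 2 * ρ 5, ρ 3 * ρ 4, ρ 3 * ρ 5, ρ 4 * ρ 5]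

/-- The first of the three perfect matchings containing a given pair. -/
def firstMatching : Fin 15 → Fin 15 :=
  ![0, 3, 6, 9, 12, 6, 3, 4, 5, 0, 1, 2, 2, 1, 0]

/-- The second of the three perfect matchings containing a given pair. -/
def secondMatching : Fin 15 → Fin 15 :=
  ![1, 4, 7, 10, 13, 9, 10, 7, 8, 11, 8, 7, 5, 4, 3]

/-- The third of the three perfect matchings containing a given pair. -/
def thirdMatching : Fin 15 → Fin 15 :=
  ![2, 5, 8, 11, 14, 12, 13, 14, 11, 14, 13, 10, 12, 9, 6]

theorem sum_matchings_through_pairs (g : Fin 15 → K) :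
    ∑ e, (g (firstMatching e) + g (secondMatching e) + g (thirdMatching e)) = 3 * ∑ m, g m := by
  simp only [Fin.sum_univ_castSucc, Fin.sum_univ_zero]
  simp [firstMatching, secondMatching, thirdMatching]
  ring

theorem triplePowerSums_matchingValue {ρ : Fin 6 → K} {s : K}
    (h : (X ^ 6 + 4 * X ^ 5 - C s * X + C s : K[X]) = ∏ i, (X - C (ρ i))) (e : Fin 15) :
    TriplePowerSums (fun k ↦ matchingValue ρ (firstMatching e) ^ k
      + matchingValue ρ (secondMatching e) ^ k + matchingValue ρ (thirdMatching e) ^ k)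
      (pairSum ρ e) (pairProd ρ e) s := by
  rw [Fin.prod_univ_six] at h
  fin_cases e
  · exact matching_triple_power_sums (p := ρ 0) (q := ρ 1) (a := ρ 2) (b := ρ 3)
      (c := ρ 4) (d := ρ 5) (h.trans (by ring))
      (show ρ 0 * ρ 1 + ρ 2 * ρ 3 + ρ 4 * ρ 5 = ρ 0 * ρ 1 + ρ 2 * ρ 3 + ρ 4 * ρ 5 by ring)
      (show ρ 0 * ρ 1 + ρ 2 * ρ 4 + ρ 3 * ρ 5 = ρ 0 * ρ 1 + ρ 2 * ρ 4 + ρ 3 * ρ 5 by ring)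
      (show ρ 0 * ρ 1 + ρ 2 * ρ 5 + ρ 3 * ρ 4 = ρ 0 * ρ 1 + ρ 2 * ρ 5 + ρ 3 * ρ 4 by ring) rfl rfl
  · exact matching_triple_power_sums (p := ρ 0) (q := ρ 2) (a := ρ 1) (b := ρ 3)
      (c := ρ 4) (d := ρ 5) (h.trans (by ring))
      (show ρ 0 * ρ 2 + ρ 1 * ρ 3 + ρ 4 * ρ 5 = ρ 0 * ρ 2 + ρ 1 * ρ 3 + ρ 4 * ρ 5 by ring)
      (show ρ 0 * ρ 2 + ρ 1 * ρ 4 + ρ 3 * ρ 5 = ρ 0 * ρ 2 + ρ 1 * ρ 4 + ρ 3 * ρ 5 by ring)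
      (show ρ 0 * ρ 2 + ρ 1 * ρ 5 + ρ 3 * ρ 4 = ρ 0 * ρ 2 + ρ 1 * ρ 5 + ρ 3 * ρ 4 by ring) rfl rfl
  · exact matching_triple_power_sums (p := ρ 0) (q := ρ 3) (a := ρ 1) (b := ρ 2)
      (c := ρ 4) (d := ρ 5) (h.trans (by ring))
      (show ρ 0 * ρ 3 + ρ 1 * ρ 2 + ρ 4 * ρ 5 = ρ 0 * ρ 3 + ρ 1 * ρ 2 + ρ 4 * ρ 5 by ring)
      (show ρ 0 * ρ 3 + ρ 1 * ρ 4 + ρ 2 * ρ 5 = ρ 0 * ρ 3 + ρ 1 * ρ 4 + ρ 2 * ρ 5 by ring)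
      (show ρ 0 * ρ 3 + ρ 1 * ρ 5 + ρ 2 * ρ 4 = ρ 0 * ρ 3 + ρ 1 * ρ 5 + ρ 2 * ρ 4 by ring) rfl rfl
  · exact matching_triple_power_sums (p := ρ 0) (q := ρ 4) (a := ρ 1) (b := ρ 2)
      (c := ρ 3) (d := ρ 5) (h.trans (by ring))
      (show ρ 0 * ρ 4 + ρ 1 * ρ 2 + ρ 3 * ρ 5 = ρ 0 * ρ 4 + ρ 1 * ρ 2 + ρ 3 * ρ 5 by ring)
      (show ρ 0 * ρ 4 + ρ 1 * ρ 3 + ρ 2 * ρ 5 = ρ 0 * ρ 4 + ρ 1 * ρ 3 + ρ 2 * ρ 5 by ring)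
      (show ρ 0 * ρ 4 + ρ 1 * ρ 5 + ρ 2 * ρ 3 = ρ 0 * ρ 4 + ρ 1 * ρ 5 + ρ 2 * ρ 3 by ring) rfl rfl
  · exact matching_triple_power_sums (p := ρ 0) (q := ρ 5) (a := ρ 1) (b := ρ 2)
      (c := ρ 3) (d := ρ 4) (h.trans (by ring))
      (show ρ 0 * ρ 5 + ρ 1 * ρ 2 + ρ 3 * ρ 4 = ρ 0 * ρ 5 + ρ 1 * ρ 2 + ρ 3 * ρ 4 by ring)
      (show ρ 0 * ρ 5 + ρ 1 * ρ 3 + ρ 2 * ρ 4 = ρ 0 * ρ 5 + ρ 1 * ρ 3 + ρ 2 * ρ 4 by ring)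
      (show ρ 0 * ρ 5 + ρ 1 * ρ 4 + ρ 2 * ρ 3 = ρ 0 * ρ 5 + ρ 1 * ρ 4 + ρ 2 * ρ 3 by ring) rfl rfl
  · exact matching_triple_power_sums (p := ρ 1) (q := ρ 2) (a := ρ 0) (b := ρ 3)
      (c := ρ 4) (d := ρ 5) (h.trans (by ring))
      (show ρ 0 * ρ 3 + ρ 1 * ρ 2 + ρ 4 * ρ 5 = ρ 1 * ρ 2 + ρ 0 * ρ 3 + ρ 4 * ρ 5 by ring)
      (show ρ 0 * ρ 4 + ρ 1 * ρ 2 + ρ 3 * ρ 5 = ρ 1 * ρ 2 + ρ 0 * ρ 4 + ρ 3 * ρ 5 by ring)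
      (show ρ 0 * ρ 5 + ρ 1 * ρ 2 + ρ 3 * ρ 4 = ρ 1 * ρ 2 + ρ 0 * ρ 5 + ρ 3 * ρ 4 by ring) rfl rfl
  · exact matching_triple_power_sums (p := ρ 1) (q := ρ 3) (a := ρ 0) (b := ρ 2)
      (c := ρ 4) (d := ρ 5) (h.trans (by ring))
      (show ρ 0 * ρ 2 + ρ 1 * ρ 3 + ρ 4 * ρ 5 = ρ 1 * ρ 3 + ρ 0 * ρ 2 + ρ 4 * ρ 5 by ring)
      (show ρ 0 * ρ 4 + ρ 1 * ρ 3 + ρ 2 * ρ 5 = ρ 1 * ρ 3 + ρ 0 * ρ 4 + ρ 2 * ρ 5 by ring)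
      (show ρ 0 * ρ 5 + ρ 1 * ρ 3 + ρ 2 * ρ 4 = ρ 1 * ρ 3 + ρ 0 * ρ 5 + ρ 2 * ρ 4 by ring) rfl rfl
  · exact matching_triple_power_sums (p := ρ 1) (q := ρ 4) (a := ρ 0) (b := ρ 2)
      (c := ρ 3) (d := ρ 5) (h.trans (by ring))
      (show ρ 0 * ρ 2 + ρ 1 * ρ 4 + ρ 3 * ρ 5 = ρ 1 * ρ 4 + ρ 0 * ρ 2 + ρ 3 * ρ 5 by ring)
      (show ρ 0 * ρ 3 + ρ 1 * ρ 4 + ρ 2 * ρ 5 = ρ 1 * ρ 4 + ρ 0 * ρ 3 + ρ 2 * ρ 5 by ring)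
      (show ρ 0 * ρ 5 + ρ 1 * ρ 4 + ρ 2 * ρ 3 = ρ 1 * ρ 4 + ρ 0 * ρ 5 + ρ 2 * ρ 3 by ring) rfl rfl
  · exact matching_triple_power_sums (p := ρ 1) (q := ρ 5) (a := ρ 0) (b := ρ 2)
      (c := ρ 3) (d := ρ 4) (h.trans (by ring))
      (show ρ 0 * ρ 2 + ρ 1 * ρ 5 + ρ 3 * ρ 4 = ρ 1 * ρ 5 + ρ 0 * ρ 2 + ρ 3 * ρ 4 by ring)
      (show ρ 0 * ρ 3 + ρ 1 * ρ 5 + ρ 2 * ρ 4 = ρ 1 * ρ 5 + ρ 0 * ρ 3 + ρ 2 * ρ 4 by ring)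
      (show ρ 0 * ρ 4 + ρ 1 * ρ 5 + ρ 2 * ρ 3 = ρ 1 * ρ 5 + ρ 0 * ρ 4 + ρ 2 * ρ 3 by ring) rfl rfl
  · exact matching_triple_power_sums (p := ρ 2) (q := ρ 3) (a := ρ 0) (b := ρ 1)
      (c := ρ 4) (d := ρ 5) (h.trans (by ring))
      (show ρ 0 * ρ 1 + ρ 2 * ρ 3 + ρ 4 * ρ 5 = ρ 2 * ρ 3 + ρ 0 * ρ 1 + ρ 4 * ρ 5 by ring)
      (show ρ 0 * ρ 4 + ρ 1 * ρ 5 + ρ 2 * ρ 3 = ρ 2 * ρ 3 + ρ 0 * ρ 4 + ρ 1 * ρ 5 by ring)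
      (show ρ 0 * ρ 5 + ρ 1 * ρ 4 + ρ 2 * ρ 3 = ρ 2 * ρ 3 + ρ 0 * ρ 5 + ρ 1 * ρ 4 by ring) rfl rfl
  · exact matching_triple_power_sums (p := ρ 2) (q := ρ 4) (a := ρ 0) (b := ρ 1)
      (c := ρ 3) (d := ρ 5) (h.trans (by ring))
      (show ρ 0 * ρ 1 + ρ 2 * ρ 4 + ρ 3 * ρ 5 = ρ 2 * ρ 4 + ρ 0 * ρ 1 + ρ 3 * ρ 5 by ring)
      (show ρ 0 * ρ 3 + ρ 1 * ρ 5 + ρ 2 * ρ 4 = ρ 2 * ρ 4 + ρ 0 * ρ 3 + ρ 1 * ρ 5 by ring)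
      (show ρ 0 * ρ 5 + ρ 1 * ρ 3 + ρ 2 * ρ 4 = ρ 2 * ρ 4 + ρ 0 * ρ 5 + ρ 1 * ρ 3 by ring) rfl rfl
  · exact matching_triple_power_sums (p := ρ 2) (q := ρ 5) (a := ρ 0) (b := ρ 1)
      (c := ρ 3) (d := ρ 4) (h.trans (by ring))
      (show ρ 0 * ρ 1 + ρ 2 * ρ 5 + ρ 3 * ρ 4 = ρ 2 * ρ 5 + ρ 0 * ρ 1 + ρ 3 * ρ 4 by ring)
      (show ρ 0 * ρ 3 + ρ 1 * ρ 4 + ρ 2 * ρ 5 = ρ 2 * ρ 5 + ρ 0 * ρ 3 + ρ 1 * ρ 4 by ring)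
      (show ρ 0 * ρ 4 + ρ 1 * ρ 3 + ρ 2 * ρ 5 = ρ 2 * ρ 5 + ρ 0 * ρ 4 + ρ 1 * ρ 3 by ring) rfl rfl
  · exact matching_triple_power_sums (p := ρ 3) (q := ρ 4) (a := ρ 0) (b := ρ 1)
      (c := ρ 2) (d := ρ 5) (h.trans (by ring))
      (show ρ 0 * ρ 1 + ρ 2 * ρ 5 + ρ 3 * ρ 4 = ρ 3 * ρ 4 + ρ 0 * ρ 1 + ρ 2 * ρ 5 by ring)
      (show ρ 0 * ρ 2 + ρ 1 * ρ 5 + ρ 3 * ρ 4 = ρ 3 * ρ 4 + ρ 0 * ρ 2 + ρ 1 * ρ 5 by ring)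
      (show ρ 0 * ρ 5 + ρ 1 * ρ 2 + ρ 3 * ρ 4 = ρ 3 * ρ 4 + ρ 0 * ρ 5 + ρ 1 * ρ 2 by ring) rfl rfl
  · exact matching_triple_power_sums (p := ρ 3) (q := ρ 5) (a := ρ 0) (b := ρ 1)
      (c := ρ 2) (d := ρ 4) (h.trans (by ring))
      (show ρ 0 * ρ 1 + ρ 2 * ρ 4 + ρ 3 * ρ 5 = ρ 3 * ρ 5 + ρ 0 * ρ 1 + ρ 2 * ρ 4 by ring)
      (show ρ 0 * ρ 2 + ρ 1 * ρ 4 + ρ 3 * ρ 5 = ρ 3 * ρ 5 + ρ 0 * ρ 2 + ρ 1 * ρ 4 by ring)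
      (show ρ 0 * ρ 4 + ρ 1 * ρ 2 + ρ 3 * ρ 5 = ρ 3 * ρ 5 + ρ 0 * ρ 4 + ρ 1 * ρ 2 by ring) rfl rfl
  · exact matching_triple_power_sums (p := ρ 4) (q := ρ 5) (a := ρ 0) (b := ρ 1)
      (c := ρ 2) (d := ρ 3) (h.trans (by ring))
      (show ρ 0 * ρ 1 + ρ 2 * ρ 3 + ρ 4 * ρ 5 = ρ 4 * ρ 5 + ρ 0 * ρ 1 + ρ 2 * ρ 3 by ring)
      (show ρ 0 * ρ 2 + ρ 1 * ρ 3 + ρ 4 * ρ 5 = ρ 4 * ρ 5 + ρ 0 * ρ 2 + ρ 1 * ρ 3 by ring)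
      (show ρ 0 * ρ 3 + ρ 1 * ρ 2 + ρ 4 * ρ 5 = ρ 4 * ρ 5 + ρ 0 * ρ 3 + ρ 1 * ρ 2 by ring) rfl rfl

theorem root_power_sums {ρ : Fin 6 → K} {s : K}
    (h : (X ^ 6 + 4 * X ^ 5 - C s * X + C s : K[X]) = ∏ i, (X - C (ρ i))) :
    ∑ i, ρ i ^ 1 = -4 ∧ ∑ i, ρ i ^ 2 = 16 ∧ ∑ i, ρ i ^ 3 = -64 ∧ ∑ i, ρ i ^ 4 = 256 ∧
    ∑ i, ρ i ^ 5 = 5 * s - 1024 ∧ ∑ i, ρ i ^ 6 = -30 * s + 4096 ∧ ∑ i, ρ i ^ 7 = 140 * s - 16384 ∧ ∑ i, ρ i ^ 8 = -640 * s + 65536 := by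
  have hroot (k : ℕ) : ∑ i, ρ i ^ (k + 6) = -4 * ∑ i, ρ i ^ (k + 5) + s * ∑ i, ρ i ^ (k + 1)
      - s * ∑ i, ρ i ^ k := by
    simp only [Finset.mul_sum, ← Finset.sum_add_distrib, ← Finset.sum_sub_distrib]
    refine Finset.sum_congr rfl fun i _ ↦ ?_
    have hi := congrArg (eval (ρ i)) h
    rw [eval_prod, Finset.prod_eq_zero (Finset.mem_univ i) (by simp)] at hi
    simp only [eval_add, eval_sub, eval_mul, eval_pow, eval_X, eval_C, eval_ofNat] at hi
    linear_combination ρ i ^ k * hi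
  rw [Fin.prod_univ_six] at h
  obtain ⟨e1, e2, e3, e4, e5, e6⟩ := coeff_relations h
  have p1 : ∑ i, ρ i ^ 1 = -4 := by
    simp only [Fin.sum_univ_six]
    linear_combination 1 * e1
  have p2 : ∑ i, ρ i ^ 2 = 16 := by
    simp only [Fin.sum_univ_six] at p1 ⊢
    linear_combination (ρ 0 + ρ 1 + ρ 2 + ρ 3 + ρ 4 + ρ 5) * e1 - 2 * e2 - 4 * p1
  have p3 : ∑ i, ρ i ^ 3 = -64 := by
    simp only [Fin.sum_univ_six] at p1 p2 ⊢
    linear_combination (ρ 0 ^ 2 + ρ 1 ^ 2 + ρ 2 ^ 2 + ρ 3 ^ 2 + ρ 4 ^ 2 + ρ 5 ^ 2) * e1 - (ρ 0 +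
      ρ 1 + ρ 2 + ρ 3 + ρ 4 + ρ 5) * e2 + 3 * e3 - 4 * p2
  have p4 : ∑ i, ρ i ^ 4 = 256 := by
    simp only [Fin.sum_univ_six] at p1 p2 p3 ⊢
    linear_combination (ρ 0 ^ 3 + ρ 1 ^ 3 + ρ 2 ^ 3 + ρ 3 ^ 3 + ρ 4 ^ 3 + ρ 5 ^ 3) * e1 - (ρ 0 ^
      2 + ρ 1 ^ 2 + ρ 2 ^ 2 + ρ 3 ^ 2 + ρ 4 ^ 2 + ρ 5 ^ 2) * e2 + (ρ 0 + ρ 1 + ρ 2 + ρ 3 + ρ 4 +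
      ρ 5) * e3 - 4 * e4 - 4 * p3
  have p5 : ∑ i, ρ i ^ 5 = 5 * s - 1024 := by
    simp only [Fin.sum_univ_six] at p1 p2 p3 p4 ⊢
    linear_combination (ρ 0 ^ 4 + ρ 1 ^ 4 + ρ 2 ^ 4 + ρ 3 ^ 4 + ρ 4 ^ 4 + ρ 5 ^ 4) * e1 - (ρ 0 ^
      3 + ρ 1 ^ 3 + ρ 2 ^ 3 + ρ 3 ^ 3 + ρ 4 ^ 3 + ρ 5 ^ 3) * e2 + (ρ 0 ^ 2 + ρ 1 ^ 2 + ρ 2 ^ 2 +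
      ρ 3 ^ 2 + ρ 4 ^ 2 + ρ 5 ^ 2) * e3 - (ρ 0 + ρ 1 + ρ 2 + ρ 3 + ρ 4 + ρ 5) * e4 + 5 * e5 - 4
      * p4
  have p6 : ∑ i, ρ i ^ 6 = -30 * s + 4096 := by
    rw [hroot 0, p5, p1]
    simp
    ring
  have p7 : ∑ i, ρ i ^ 7 = 140 * s - 16384 := by
    rw [hroot 1, p6, p2, p1]
    ring
  have p8 : ∑ i, ρ i ^ 8 = -640 * s + 65536 := by
    rw [hroot 2, p7, p3, p2]
    ring
  exact ⟨p1, p2, p3, p4, p5, p6, p7, p8⟩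

/-- The moments `∑ u ^ i * v ^ j` over the fifteen pairs, for `i + j ≤ 4`. -/
structure PairMoments {ι : Type*} [Fintype ι] (u v : ι → K) (s : K) : Prop where
  moment_0_0 : ∑ _e : ι, (1 : K) = 15
  moment_0_1 : ∑ e : ι, v e = 0
  moment_0_2 : ∑ e : ι, v e ^ 2 = 0
  moment_0_3 : ∑ e : ι, v e ^ 3 = 15 * s
  moment_0_4 : ∑ e : ι, v e ^ 4 = 320 * s
  moment_1_0 : ∑ e : ι, u e = -20
  moment_1_1 : ∑ e : ι, u e * v e = 0
  moment_1_2 : ∑ e : ι, u e * v e ^ 2 = -5 * s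
  moment_1_3 : ∑ e : ι, u e * v e ^ 3 = -140 * s
  moment_2_0 : ∑ e : ι, u e ^ 2 = 80
  moment_2_1 : ∑ e : ι, u e ^ 2 * v e = 0
  moment_2_2 : ∑ e : ι, u e ^ 2 * v e ^ 2 = 60 * s
  moment_3_0 : ∑ e : ι, u e ^ 3 = -320
  moment_3_1 : ∑ e : ι, u e ^ 3 * v e = -20 * s
  moment_4_0 : ∑ e : ι, u e ^ 4 = 1280

/-- The values for `k = 1, …, 15` of the power sums of the fifteen matching values. -/
structure MatchingPowerSums (T : ℕ → K) (s : K) : Prop where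
  psum_1 : T 1 = 0
  psum_2 : T 2 = 0
  psum_3 : T 3 = 210 * s
  psum_4 : T 4 = 1280 * s
  psum_5 : T 5 = 105 * s ^ 2 + 3840 * s
  psum_6 : T 6 = 6150 * s ^ 2
  psum_7 : T 7 = 75600 * s ^ 2
  psum_8 : T 8 = 7920 * s ^ 3 + 450560 * s ^ 2
  psum_9 : T 9 = 277410 * s ^ 3 + 737280 * s ^ 2
  psum_10 : T 10 = 5735 * s ^ 4 + 4053760 * s ^ 3 + 983040 * s ^ 2
  psum_11 : T 11 = 494725 * s ^ 4 + 34284800 * s ^ 3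
  psum_12 : T 12 = 15078150 * s ^ 4 + 129843200 * s ^ 3
  psum_13 : T 13 = 574340 * s ^ 5 + 231588240 * s ^ 4 + 315228160 * s ^ 3
  psum_14 : T 14 = 30480520 * s ^ 5 + 2329304320 * s ^ 4 + 293601280 * s ^ 3
  psum_15 : T 15 = 157020 * s ^ 6 + 858245730 * s ^ 5 + 13391523840 * s ^ 4 + 251658240 * s ^ 3

set_option maxHeartbeats 4000000 in
theorem sum_of_triplePowerSums {ι : Type*} [Fintype ι] {T : ι → ℕ → K} {u v : ι → K} {s : K}
    (hT : ∀ e, TriplePowerSums (T e) (u e) (v e) s) (hm : PairMoments u v s) :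
    ∑ e, T e 1 = 3 * (0) ∧
    ∑ e, T e 2 = 3 * (0) ∧
    ∑ e, T e 3 = 3 * (210 * s) ∧
    ∑ e, T e 4 = 3 * (1280 * s) ∧
    ∑ e, T e 5 = 3 * (105 * s ^ 2 + 3840 * s) ∧
    ∑ e, T e 6 = 3 * (6150 * s ^ 2) ∧
    ∑ e, T e 7 = 3 * (75600 * s ^ 2) ∧
    ∑ e, T e 8 = 3 * (7920 * s ^ 3 + 450560 * s ^ 2) ∧
    ∑ e, T e 9 = 3 * (277410 * s ^ 3 + 737280 * s ^ 2) ∧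
    ∑ e, T e 10 = 3 * (5735 * s ^ 4 + 4053760 * s ^ 3 + 983040 * s ^ 2) ∧
    ∑ e, T e 11 = 3 * (494725 * s ^ 4 + 34284800 * s ^ 3) ∧
    ∑ e, T e 12 = 3 * (15078150 * s ^ 4 + 129843200 * s ^ 3) ∧
    ∑ e, T e 13 = 3 * (574340 * s ^ 5 + 231588240 * s ^ 4 + 315228160 * s ^ 3) ∧
    ∑ e, T e 14 = 3 * (30480520 * s ^ 5 + 2329304320 * s ^ 4 + 293601280 * s ^ 3) ∧
    ∑ e, T e 15 = 3 * (157020 * s ^ 6 + 858245730 * s ^ 5 + 13391523840 * s ^ 4 + 251658240 * s ^ 3) := by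
  refine ⟨?_, ?_, ?_, ?_, ?_, ?_, ?_, ?_, ?_, ?_, ?_, ?_, ?_, ?_, ?_⟩
  · have :
        ∑ e, T e 1 = (2) * ∑ e : ι, v e + (4) * ∑ e : ι, u e + (1) * ∑ e : ι, u e ^ 2 := by
      simp only [Finset.mul_sum, ← Finset.sum_add_distrib]
      refine Finset.sum_congr rfl fun e _ ↦ ?_
      rw [(hT e).psum_1]
      ring
    rw [this, hm.moment_0_1, hm.moment_1_0, hm.moment_2_0]
    ring
  · have :
        ∑ e, T e 2 = (32) * ∑ e : ι, v e + (10) * ∑ e : ι, v e ^ 2 + (-40) * ∑ e : ι, u e * v e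
          + (-16) * ∑ e : ι, u e ^ 2 + (-20) * ∑ e : ι, u e ^ 2 * v e + (24) * ∑ e : ι, u e ^ 3
          + (7) * ∑ e : ι, u e ^ 4 := by
      simp only [Finset.mul_sum, ← Finset.sum_add_distrib]
      refine Finset.sum_congr rfl fun e _ ↦ ?_
      rw [(hT e).psum_2]
      ring
    rw [this, hm.moment_0_1, hm.moment_0_2, hm.moment_1_1, hm.moment_2_0, hm.moment_2_1,
      hm.moment_3_0, hm.moment_4_0]
    ring
  · have :
        ∑ e, T e 3 = (42 * s) * ∑ e : ι, (1 : K) + (64) * ∑ e : ι, v e ^ 2 + (4) * ∑ e : ι, v e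
          ^ 3 + (4 * s) * ∑ e : ι, u e + (-192) * ∑ e : ι, u e * v e + (16) * ∑ e : ι, u e * v e
          ^ 2 + (-48) * ∑ e : ι, u e ^ 2 * v e + (3) * ∑ e : ι, u e ^ 2 * v e ^ 2 + (64) * ∑ e :
          ι, u e ^ 3 + (4) * ∑ e : ι, u e ^ 3 * v e + (16) * ∑ e : ι, u e ^ 4 := by
      simp only [Finset.mul_sum, ← Finset.sum_add_distrib]
      refine Finset.sum_congr rfl fun e _ ↦ ?_
      rw [(hT e).psum_3]
      ring
    rw [this, hm.moment_0_0, hm.moment_0_2, hm.moment_0_3, hm.moment_1_0, hm.moment_1_1,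
      hm.moment_1_2, hm.moment_2_1, hm.moment_2_2, hm.moment_3_0, hm.moment_3_1, hm.moment_4_0]
    ring
  · have :
        ∑ e, T e 4 = (352 * s) * ∑ e : ι, (1 : K) + (22 * s) * ∑ e : ι, v e + (-256) * ∑ e : ι,
          v e ^ 2 + (512) * ∑ e : ι, v e ^ 3 + (36) * ∑ e : ι, v e ^ 4 + (-4 * s) * ∑ e : ι, u e
          + (-41 * s) * ∑ e : ι, u e * v e + (-640) * ∑ e : ι, u e * v e ^ 2 + (96) * ∑ e : ι, u
          e * v e ^ 3 + (73 * s) * ∑ e : ι, u e ^ 2 + (256) * ∑ e : ι, u e ^ 2 * v e + (-128) *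
          ∑ e : ι, u e ^ 2 * v e ^ 2 + (23 * s) * ∑ e : ι, u e ^ 3 + (64) * ∑ e : ι, u e ^ 3 * v
          e := by
      simp only [Finset.mul_sum, ← Finset.sum_add_distrib]
      refine Finset.sum_congr rfl fun e _ ↦ ?_
      rw [(hT e).psum_4]
      ring
    rw [this, hm.moment_0_0, hm.moment_0_1, hm.moment_0_2, hm.moment_0_3, hm.moment_0_4,
      hm.moment_1_0, hm.moment_1_1, hm.moment_1_2, hm.moment_1_3, hm.moment_2_0, hm.moment_2_1,
      hm.moment_2_2, hm.moment_3_0, hm.moment_3_1]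
    ring
  · have :
        ∑ e, T e 5 = (21 * s ^ 2 + 768 * s) * ∑ e : ι, (1 : K) + (1440 * s) * ∑ e : ι, v e +
          (430 * s) * ∑ e : ι, v e ^ 2 + (1280) * ∑ e : ι, v e ^ 3 + (80) * ∑ e : ι, v e ^ 4 +
          (320 * s) * ∑ e : ι, u e + (-1400 * s) * ∑ e : ι, u e * v e + (20 * s) * ∑ e : ι, u e
          * v e ^ 2 + (320) * ∑ e : ι, u e * v e ^ 3 + (-80 * s) * ∑ e : ι, u e ^ 2 + (-690 * s)
          * ∑ e : ι, u e ^ 2 * v e + (900 * s) * ∑ e : ι, u e ^ 3 + (-5 * s) * ∑ e : ι, u e ^ 3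
          * v e + (235 * s) * ∑ e : ι, u e ^ 4 := by
      simp only [Finset.mul_sum, ← Finset.sum_add_distrib]
      refine Finset.sum_congr rfl fun e _ ↦ ?_
      rw [(hT e).psum_5]
      ring
    rw [this, hm.moment_0_0, hm.moment_0_1, hm.moment_0_2, hm.moment_0_3, hm.moment_0_4,
      hm.moment_1_0, hm.moment_1_1, hm.moment_1_2, hm.moment_1_3, hm.moment_2_0, hm.moment_2_1,
      hm.moment_3_0, hm.moment_3_1, hm.moment_4_0]
    ring
  · have :
        ∑ e, T e 6 = (1040 * s ^ 2) * ∑ e : ι, (1 : K) + (-26 * s ^ 2 + 5632 * s) * ∑ e : ι, v e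
          + (8800 * s) * ∑ e : ι, v e ^ 2 + (610 * s) * ∑ e : ι, v e ^ 3 + (278 * s ^ 2 + 1024 *
          s) * ∑ e : ι, u e + (-18240 * s) * ∑ e : ι, u e * v e + (2540 * s) * ∑ e : ι, u e * v
          e ^ 2 + (95 * s) * ∑ e : ι, u e * v e ^ 3 + (82 * s ^ 2 + 256 * s) * ∑ e : ι, u e ^ 2
          + (-8160 * s) * ∑ e : ι, u e ^ 2 * v e + (225 * s) * ∑ e : ι, u e ^ 2 * v e ^ 2 +
          (8960 * s) * ∑ e : ι, u e ^ 3 + (-260 * s) * ∑ e : ι, u e ^ 3 * v e + (2240 * s) * ∑ e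
          : ι, u e ^ 4 := by
      simp only [Finset.mul_sum, ← Finset.sum_add_distrib]
      refine Finset.sum_congr rfl fun e _ ↦ ?_
      rw [(hT e).psum_6]
      ring
    rw [this, hm.moment_0_0, hm.moment_0_1, hm.moment_0_2, hm.moment_0_3, hm.moment_1_0,
      hm.moment_1_1, hm.moment_1_2, hm.moment_1_3, hm.moment_2_0, hm.moment_2_1, hm.moment_2_2,
      hm.moment_3_0, hm.moment_3_1, hm.moment_4_0]
    ring
  · have :
        ∑ e, T e 7 = (17600 * s ^ 2) * ∑ e : ι, (1 : K) + (504 * s ^ 2 + 8192 * s) * ∑ e : ι, v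
          e + (230 * s ^ 2 + 30720 * s) * ∑ e : ι, v e ^ 2 + (27040 * s) * ∑ e : ι, v e ^ 3 +
          (1750 * s) * ∑ e : ι, v e ^ 4 + (1080 * s ^ 2) * ∑ e : ι, u e + (-2510 * s ^ 2 - 51200
          * s) * ∑ e : ι, u e * v e + (-3200 * s) * ∑ e : ι, u e * v e ^ 2 + (5760 * s) * ∑ e :
          ι, u e * v e ^ 3 + (3623 * s ^ 2 - 4096 * s) * ∑ e : ι, u e ^ 2 + (-305 * s ^ 2 -
          14080 * s) * ∑ e : ι, u e ^ 2 * v e + (-1840 * s) * ∑ e : ι, u e ^ 2 * v e ^ 2 + (1453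
          * s ^ 2 + 26624 * s) * ∑ e : ι, u e ^ 3 + (1600 * s) * ∑ e : ι, u e ^ 3 * v e + (99 *
          s ^ 2 + 6912 * s) * ∑ e : ι, u e ^ 4 := by
      simp only [Finset.mul_sum, ← Finset.sum_add_distrib]
      refine Finset.sum_congr rfl fun e _ ↦ ?_
      rw [(hT e).psum_7]
      ring
    rw [this, hm.moment_0_0, hm.moment_0_1, hm.moment_0_2, hm.moment_0_3, hm.moment_0_4,
      hm.moment_1_0, hm.moment_1_1, hm.moment_1_2, hm.moment_1_3, hm.moment_2_0, hm.moment_2_1,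
      hm.moment_2_2, hm.moment_3_0, hm.moment_3_1, hm.moment_4_0]
    ring
  · have :
        ∑ e, T e 8 = (1584 * s ^ 3 + 97792 * s ^ 2) * ∑ e : ι, (1 : K) + (46240 * s ^ 2) * ∑ e :
          ι, v e + (20938 * s ^ 2 + 16384 * s) * ∑ e : ι, v e ^ 2 + (-52 * s ^ 2 + 262144 * s) *
          ∑ e : ι, v e ^ 3 + (16640 * s) * ∑ e : ι, v e ^ 4 + (303 * s ^ 3 + 7424 * s ^ 2) * ∑ e
          : ι, u e + (-63144 * s ^ 2 - 49152 * s) * ∑ e : ι, u e * v e + (3152 * s ^ 2 - 36864 *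
          s) * ∑ e : ι, u e * v e ^ 2 + (62720 * s) * ∑ e : ι, u e * v e ^ 3 + (28240 * s ^ 2) *
          ∑ e : ι, u e ^ 2 + (-24356 * s ^ 2 + 8192 * s) * ∑ e : ι, u e ^ 2 * v e + (316 * s ^ 2
          - 8192 * s) * ∑ e : ι, u e ^ 2 * v e ^ 2 + (40008 * s ^ 2 + 16384 * s) * ∑ e : ι, u e
          ^ 3 + (-182 * s ^ 2 + 6144 * s) * ∑ e : ι, u e ^ 3 * v e + (8227 * s ^ 2 + 4096 * s) *
          ∑ e : ι, u e ^ 4 := by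
      simp only [Finset.mul_sum, ← Finset.sum_add_distrib]
      refine Finset.sum_congr rfl fun e _ ↦ ?_
      rw [(hT e).psum_8]
      ring
    rw [this, hm.moment_0_0, hm.moment_0_1, hm.moment_0_2, hm.moment_0_3, hm.moment_0_4,
      hm.moment_1_0, hm.moment_1_1, hm.moment_1_2, hm.moment_1_3, hm.moment_2_0, hm.moment_2_1,
      hm.moment_2_2, hm.moment_3_0, hm.moment_3_1, hm.moment_4_0]
    ring
  · have :
        ∑ e, T e 9 = (44874 * s ^ 3 + 192512 * s ^ 2) * ∑ e : ι, (1 : K) + (-2316 * s ^ 3 +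
          460032 * s ^ 2) * ∑ e : ι, v e + (516608 * s ^ 2 - 65536 * s) * ∑ e : ι, v e ^ 2 +
          (45324 * s ^ 2 + 847872 * s) * ∑ e : ι, v e ^ 3 + (982 * s ^ 2 + 54016 * s) * ∑ e : ι,
          v e ^ 4 + (15282 * s ^ 3 + 45056 * s ^ 2) * ∑ e : ι, u e + (-927 * s ^ 3 - 1043776 * s
          ^ 2) * ∑ e : ι, u e * v e + (149760 * s ^ 2 - 327680 * s) * ∑ e : ι, u e * v e ^ 2 +
          (9232 * s ^ 2 + 193536 * s) * ∑ e : ι, u e * v e ^ 3 + (6381 * s ^ 3 + 115968 * s ^ 2)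
          * ∑ e : ι, u e ^ 2 + (-480368 * s ^ 2 + 65536 * s) * ∑ e : ι, u e ^ 2 * v e + (13199 *
          s ^ 2 - 73728 * s) * ∑ e : ι, u e ^ 2 * v e ^ 2 + (436 * s ^ 3 + 566208 * s ^ 2) * ∑ e
          : ι, u e ^ 3 + (-17452 * s ^ 2 + 16384 * s) * ∑ e : ι, u e ^ 3 * v e + (134640 * s ^
          2) * ∑ e : ι, u e ^ 4 := by
      simp only [Finset.mul_sum, ← Finset.sum_add_distrib]
      refine Finset.sum_congr rfl fun e _ ↦ ?_
      rw [(hT e).psum_9]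
      ring
    rw [this, hm.moment_0_0, hm.moment_0_1, hm.moment_0_2, hm.moment_0_3, hm.moment_0_4,
      hm.moment_1_0, hm.moment_1_1, hm.moment_1_2, hm.moment_1_3, hm.moment_2_0, hm.moment_2_1,
      hm.moment_2_2, hm.moment_3_0, hm.moment_3_1, hm.moment_4_0]
    ring
  · have :
        ∑ e, T e 10 = (1147 * s ^ 4 + 812352 * s ^ 3 + 196608 * s ^ 2) * ∑ e : ι, (1 : K) +
          (22410 * s ^ 3 + 1863680 * s ^ 2) * ∑ e : ι, v e + (18570 * s ^ 3 + 4245760 * s ^ 2) *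
          ∑ e : ι, v e ^ 2 + (1409920 * s ^ 2 + 655360 * s) * ∑ e : ι, v e ^ 3 + (79520 * s ^ 2
          + 40960 * s) * ∑ e : ι, v e ^ 4 + (156980 * s ^ 3 + 163840 * s ^ 2) * ∑ e : ι, u e +
          (-136275 * s ^ 3 - 6118400 * s ^ 2) * ∑ e : ι, u e * v e + (-220 * s ^ 3 + 1178240 * s
          ^ 2) * ∑ e : ι, u e * v e ^ 2 + (317280 * s ^ 2 + 163840 * s) * ∑ e : ι, u e * v e ^ 3
          + (189505 * s ^ 3 - 143360 * s ^ 2) * ∑ e : ι, u e ^ 2 + (-26360 * s ^ 3 - 2746880 * s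
          ^ 2) * ∑ e : ι, u e ^ 2 * v e + (78000 * s ^ 2) * ∑ e : ι, u e ^ 2 * v e ^ 2 + (79475
          * s ^ 3 + 3276800 * s ^ 2) * ∑ e : ι, u e ^ 3 + (55 * s ^ 3 - 66560 * s ^ 2) * ∑ e :
          ι, u e ^ 3 * v e + (8665 * s ^ 3 + 830720 * s ^ 2) * ∑ e : ι, u e ^ 4 := by
      simp only [Finset.mul_sum, ← Finset.sum_add_distrib]
      refine Finset.sum_congr rfl fun e _ ↦ ?_
      rw [(hT e).psum_10]
      ring
    rw [this, hm.moment_0_0, hm.moment_0_1, hm.moment_0_2, hm.moment_0_3, hm.moment_0_4,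
      hm.moment_1_0, hm.moment_1_1, hm.moment_1_2, hm.moment_1_3, hm.moment_2_0, hm.moment_2_1,
      hm.moment_2_2, hm.moment_3_0, hm.moment_3_1, hm.moment_4_0]
    ring
  · have :
        ∑ e, T e 11 = (95535 * s ^ 4 + 7009280 * s ^ 3) * ∑ e : ι, (1 : K) + (288 * s ^ 4 +
          1633568 * s ^ 3 + 2752512 * s ^ 2) * ∑ e : ι, v e + (1155950 * s ^ 3 + 15667200 * s ^
          2) * ∑ e : ι, v e ^ 2 + (8390 * s ^ 3 + 19480320 * s ^ 2) * ∑ e : ι, v e ^ 3 +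
          (1194000 * s ^ 2) * ∑ e : ι, v e ^ 4 + (24946 * s ^ 4 + 819136 * s ^ 3 + 262144 * s ^
          2) * ∑ e : ι, u e + (-3447560 * s ^ 3 - 17940480 * s ^ 2) * ∑ e : ι, u e * v e +
          (223760 * s ^ 3 + 4398080 * s ^ 2) * ∑ e : ι, u e * v e ^ 2 + (1705 * s ^ 3 + 4699840
          * s ^ 2) * ∑ e : ι, u e * v e ^ 3 + (1849 * s ^ 4 + 2364384 * s ^ 3 + 65536 * s ^ 2) *
          ∑ e : ι, u e ^ 2 + (-1158790 * s ^ 3 - 6942720 * s ^ 2) * ∑ e : ι, u e ^ 2 * v e +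
          (23125 * s ^ 3 + 288000 * s ^ 2) * ∑ e : ι, u e ^ 2 * v e ^ 2 + (2100940 * s ^ 3 +
          8683520 * s ^ 2) * ∑ e : ι, u e ^ 3 + (-12315 * s ^ 3 - 30720 * s ^ 2) * ∑ e : ι, u e
          ^ 3 * v e + (378935 * s ^ 3 + 2170880 * s ^ 2) * ∑ e : ι, u e ^ 4 := by
      simp only [Finset.mul_sum, ← Finset.sum_add_distrib]
      refine Finset.sum_congr rfl fun e _ ↦ ?_
      rw [(hT e).psum_11]
      ring
    rw [this, hm.moment_0_0, hm.moment_0_1, hm.moment_0_2, hm.moment_0_3, hm.moment_0_4,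
      hm.moment_1_0, hm.moment_1_1, hm.moment_1_2, hm.moment_1_3, hm.moment_2_0, hm.moment_2_1,
      hm.moment_2_2, hm.moment_3_0, hm.moment_3_1, hm.moment_4_0]
    ring
  · have :
        ∑ e, T e 12 = (2552700 * s ^ 4 + 29081600 * s ^ 3) * ∑ e : ι, (1 : K) + (-99262 * s ^ 4
          + 25550848 * s ^ 3 + 2097152 * s ^ 2) * ∑ e : ι, v e + (8480 * s ^ 4 + 27795200 * s ^
          3 + 21626880 * s ^ 2) * ∑ e : ι, v e ^ 2 + (2635110 * s ^ 3 + 123514880 * s ^ 2) * ∑ e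
          : ι, v e ^ 3 + (86650 * s ^ 3 + 7801600 * s ^ 2) * ∑ e : ι, v e ^ 4 + (843870 * s ^ 4
          + 2319360 * s ^ 3) * ∑ e : ι, u e + (-109880 * s ^ 4 - 57191360 * s ^ 3 - 23592960 * s
          ^ 2) * ∑ e : ι, u e * v e + (7966100 * s ^ 3 - 9830400 * s ^ 2) * ∑ e : ι, u e * v e ^
          2 + (578065 * s ^ 3 + 29649920 * s ^ 2) * ∑ e : ι, u e * v e ^ 3 + (368031 * s ^ 4 +
          15762176 * s ^ 3 - 1048576 * s ^ 2) * ∑ e : ι, u e ^ 2 + (-13165 * s ^ 4 - 24588000 *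
          s ^ 3 - 2621440 * s ^ 2) * ∑ e : ι, u e ^ 2 * v e + (739065 * s ^ 3 - 3194880 * s ^ 2)
          * ∑ e : ι, u e ^ 2 * v e ^ 2 + (57541 * s ^ 4 + 32344256 * s ^ 3 + 12058624 * s ^ 2) *
          ∑ e : ι, u e ^ 3 + (-814900 * s ^ 3 + 1638400 * s ^ 2) * ∑ e : ι, u e ^ 3 * v e +
          (4418 * s ^ 4 + 7082768 * s ^ 3 + 3080192 * s ^ 2) * ∑ e : ι, u e ^ 4 := by
      simp only [Finset.mul_sum, ← Finset.sum_add_distrib]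
      refine Finset.sum_congr rfl fun e _ ↦ ?_
      rw [(hT e).psum_12]
      ring
    rw [this, hm.moment_0_0, hm.moment_0_1, hm.moment_0_2, hm.moment_0_3, hm.moment_0_4,
      hm.moment_1_0, hm.moment_1_1, hm.moment_1_2, hm.moment_1_3, hm.moment_2_0, hm.moment_2_1,
      hm.moment_2_2, hm.moment_3_0, hm.moment_3_1, hm.moment_4_0]
    ring
  · have :
        ∑ e, T e 13 = (114868 * s ^ 5 + 42760768 * s ^ 4 + 68616192 * s ^ 3) * ∑ e : ι, (1 : K)
          + (1127460 * s ^ 4 + 177172480 * s ^ 3) * ∑ e : ι, v e + (1290296 * s ^ 4 + 319750656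
          * s ^ 3 + 4194304 * s ^ 2) * ∑ e : ι, v e ^ 2 + (576 * s ^ 4 + 77613056 * s ^ 3 +
          373161984 * s ^ 2) * ∑ e : ι, v e ^ 3 + (4030410 * s ^ 3 + 23470080 * s ^ 2) * ∑ e :
          ι, v e ^ 4 + (7671 * s ^ 5 + 11691136 * s ^ 4 + 10502144 * s ^ 3) * ∑ e : ι, u e +
          (-7567308 * s ^ 4 - 487216128 * s ^ 3 - 12582912 * s ^ 2) * ∑ e : ι, u e * v e +
          (47544 * s ^ 4 + 101477184 * s ^ 3 - 33030144 * s ^ 2) * ∑ e : ι, u e * v e ^ 2 +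
          (17900080 * s ^ 3 + 91095040 * s ^ 2) * ∑ e : ι, u e * v e ^ 3 + (10440335 * s ^ 4 +
          39137280 * s ^ 3) * ∑ e : ι, u e ^ 2 + (-1714907 * s ^ 4 - 226487552 * s ^ 3 + 7340032
          * s ^ 2) * ∑ e : ι, u e ^ 2 * v e + (7527 * s ^ 4 + 8793952 * s ^ 3 - 7667712 * s ^ 2)
          * ∑ e : ι, u e ^ 2 * v e ^ 2 + (4404301 * s ^ 4 + 267959296 * s ^ 3 + 4194304 * s ^ 2)
          * ∑ e : ι, u e ^ 3 + (3456 * s ^ 4 - 8331904 * s ^ 3 + 2883584 * s ^ 2) * ∑ e : ι, u e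
          ^ 3 * v e + (567594 * s ^ 4 + 64641024 * s ^ 3 + 1048576 * s ^ 2) * ∑ e : ι, u e ^ 4
          := by
      simp only [Finset.mul_sum, ← Finset.sum_add_distrib]
      refine Finset.sum_congr rfl fun e _ ↦ ?_
      rw [(hT e).psum_13]
      ring
    rw [this, hm.moment_0_0, hm.moment_0_1, hm.moment_0_2, hm.moment_0_3, hm.moment_0_4,
      hm.moment_1_0, hm.moment_1_1, hm.moment_1_2, hm.moment_1_3, hm.moment_2_0, hm.moment_2_1,
      hm.moment_2_2, hm.moment_3_0, hm.moment_3_1, hm.moment_4_0]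
    ring
  · have :
        ∑ e, T e 14 = (5758988 * s ^ 5 + 447961088 * s ^ 4 + 75497472 * s ^ 3) * ∑ e : ι, (1 :
          K) + (-10902 * s ^ 5 + 72087008 * s ^ 4 + 591265792 * s ^ 3) * ∑ e : ι, v e +
          (65491306 * s ^ 4 + 1986871296 * s ^ 3 - 16777216 * s ^ 2) * ∑ e : ι, v e ^ 2 +
          (1525748 * s ^ 4 + 1209676288 * s ^ 3 + 557842432 * s ^ 2) * ∑ e : ι, v e ^ 3 + (33234
          * s ^ 4 + 70870784 * s ^ 3 + 35127296 * s ^ 2) * ∑ e : ι, v e ^ 4 + (1517219 * s ^ 5 +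
          87013504 * s ^ 4 + 36438016 * s ^ 3) * ∑ e : ι, u e + (-33844 * s ^ 5 - 198201544 * s
          ^ 4 - 2364686336 * s ^ 3) * ∑ e : ι, u e * v e + (13088400 * s ^ 4 + 704578560 * s ^ 3
          - 125829120 * s ^ 2) * ∑ e : ι, u e * v e ^ 2 + (301494 * s ^ 4 + 292433024 * s ^ 3 +
          132120576 * s ^ 2) * ∑ e : ι, u e * v e ^ 3 + (248632 * s ^ 5 + 152575392 * s ^ 4 +
          67698688 * s ^ 3) * ∑ e : ι, u e ^ 2 + (-64452096 * s ^ 4 - 1095663616 * s ^ 3 +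
          16777216 * s ^ 2) * ∑ e : ι, u e ^ 2 * v e + (1308333 * s ^ 4 + 65659648 * s ^ 3 -
          29360128 * s ^ 2) * ∑ e : ι, u e ^ 2 * v e ^ 2 + (17227 * s ^ 5 + 117792912 * s ^ 4 +
          1232928768 * s ^ 3) * ∑ e : ι, u e ^ 3 + (-832664 * s ^ 4 - 42753024 * s ^ 3 + 4194304
          * s ^ 2) * ∑ e : ι, u e ^ 3 * v e + (20579335 * s ^ 4 + 304455680 * s ^ 3) * ∑ e : ι,
          u e ^ 4 := by
      simp only [Finset.mul_sum, ← Finset.sum_add_distrib]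
      refine Finset.sum_congr rfl fun e _ ↦ ?_
      rw [(hT e).psum_14]
      ring
    rw [this, hm.moment_0_0, hm.moment_0_1, hm.moment_0_2, hm.moment_0_3, hm.moment_0_4,
      hm.moment_1_0, hm.moment_1_1, hm.moment_1_2, hm.moment_1_3, hm.moment_2_0, hm.moment_2_1,
      hm.moment_2_2, hm.moment_3_0, hm.moment_3_1, hm.moment_4_0]
    ring
  · have :
        ∑ e, T e 15 = (31404 * s ^ 6 + 150841246 * s ^ 5 + 2741485568 * s ^ 4 + 50331648 * s ^
          3) * ∑ e : ι, (1 : K) + (-3014070 * s ^ 5 + 1339649280 * s ^ 4 + 1148190720 * s ^ 3) *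
          ∑ e : ι, v e + (1011760 * s ^ 5 + 1534371360 * s ^ 4 + 6739722240 * s ^ 3) * ∑ e : ι,
          v e ^ 2 + (148959160 * s ^ 4 + 10635202560 * s ^ 3 + 251658240 * s ^ 2) * ∑ e : ι, v e
          ^ 3 + (5725910 * s ^ 4 + 656431360 * s ^ 3 + 15728640 * s ^ 2) * ∑ e : ι, v e ^ 4 +
          (47264790 * s ^ 5 + 343920640 * s ^ 4 + 62914560 * s ^ 3) * ∑ e : ι, u e + (-8698600 *
          s ^ 5 - 3285956800 * s ^ 4 - 6356992000 * s ^ 3) * ∑ e : ι, u e * v e + (2440 * s ^ 5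
          + 427930040 * s ^ 4 + 2023260160 * s ^ 3) * ∑ e : ι, u e * v e ^ 2 + (33307590 * s ^ 4
          + 2594135040 * s ^ 3 + 62914560 * s ^ 2) * ∑ e : ι, u e * v e ^ 3 + (20669490 * s ^ 5
          + 1348285440 * s ^ 4 - 94371840 * s ^ 3) * ∑ e : ι, u e ^ 2 + (-1545880 * s ^ 5 -
          1317472080 * s ^ 4 - 2670264320 * s ^ 3) * ∑ e : ι, u e ^ 2 * v e + (40640375 * s ^ 4
          + 134656000 * s ^ 3) * ∑ e : ι, u e ^ 2 * v e ^ 2 + (4792925 * s ^ 5 + 1884740800 * s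
          ^ 4 + 3289907200 * s ^ 3) * ∑ e : ι, u e ^ 3 + (-610 * s ^ 5 - 38645260 * s ^ 4 -
          43991040 * s ^ 3) * ∑ e : ι, u e ^ 3 * v e + (517420 * s ^ 5 + 387449120 * s ^ 4 +
          829358080 * s ^ 3) * ∑ e : ι, u e ^ 4 := by
      simp only [Finset.mul_sum, ← Finset.sum_add_distrib]
      refine Finset.sum_congr rfl fun e _ ↦ ?_
      rw [(hT e).psum_15]
      ring
    rw [this, hm.moment_0_0, hm.moment_0_1, hm.moment_0_2, hm.moment_0_3, hm.moment_0_4,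
      hm.moment_1_0, hm.moment_1_1, hm.moment_1_2, hm.moment_1_3, hm.moment_2_0, hm.moment_2_1,
      hm.moment_2_2, hm.moment_3_0, hm.moment_3_1, hm.moment_4_0]
    ring

theorem newton_recurrence {n : ℕ} (w : Fin n → K) (k : ℕ) :
    (k + 1 : K) * (Finset.univ.val.map w).esymm (k + 1) =
      ∑ i ∈ Finset.range (k + 1),
        (-1) ^ i * (Finset.univ.val.map w).esymm (k - i) * ∑ m, w m ^ (i + 1) := by
  have := congrArg (MvPolynomial.aeval w) (MvPolynomial.mul_esymm_eq_sum (Fin n) K (k + 1))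
  simp only [map_mul, map_sum, map_pow, map_neg, map_one, map_natCast,
    MvPolynomial.aeval_esymm_eq_multiset_esymm, MvPolynomial.psum, MvPolynomial.aeval_X] at this
  push_cast at this
  rw [this, Finset.sum_filter, Finset.Nat.sum_antidiagonal_eq_sum_range_succ_mk,
    Finset.sum_range_succ, ← Finset.sum_range_reflect, Finset.mul_sum]
  simp only [lt_self_iff_false, if_false, add_zero, Finset.mul_sum]
  refine Finset.sum_congr rfl fun i hi ↦ ?_
  obtain ⟨j, rfl⟩ := Nat.exists_eq_add_of_le (Finset.mem_range_succ_iff.1 hi)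
  have h1 : i + j + 1 - 1 - i = j := by omega
  have h2 : i + j + 1 - j = i + 1 := by omega
  have h3 : i + j - i = j := by omega
  rw [h1, h2, h3, if_pos (by omega), Finset.mul_sum]
  refine Finset.sum_congr rfl fun m _ ↦ ?_
  have hsign : (-1 : K) ^ (i + j + 1 + 1) * (-1) ^ j = (-1) ^ i := by
    rw [show i + j + 1 + 1 = i + (j + 2) by omega, pow_add, mul_assoc, ← pow_add,
      Even.neg_one_pow (n := j + 2 + j) ⟨j + 1, by omega⟩, mul_one]
  rw [← hsign]
  ring

end Matchings

section MatchingPowerSums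

variable {K : Type*} [Field K] [CharZero K]

theorem pairMoments {ρ : Fin 6 → K} {s : K}
    (h : (X ^ 6 + 4 * X ^ 5 - C s * X + C s : K[X]) = ∏ i, (X - C (ρ i))) :
    PairMoments (pairSum ρ) (pairProd ρ) s := by
  obtain ⟨p1, p2, p3, p4, p5, p6, p7, p8⟩ := root_power_sums h
  have expand (f : K → K → K) : ∑ e, f (pairSum ρ e) (pairProd ρ e) =
      f (ρ 0 + ρ 1) (ρ 0 * ρ 1) + f (ρ 0 + ρ 2) (ρ 0 * ρ 2) + f (ρ 0 + ρ 3) (ρ 0 * ρ 3) + f (ρ 0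
        + ρ 4) (ρ 0 * ρ 4) + f (ρ 0 + ρ 5) (ρ 0 * ρ 5) + f (ρ 1 + ρ 2) (ρ 1 * ρ 2) + f (ρ 1 + ρ
        3) (ρ 1 * ρ 3) + f (ρ 1 + ρ 4) (ρ 1 * ρ 4) + f (ρ 1 + ρ 5) (ρ 1 * ρ 5) + f (ρ 2 + ρ 3)
        (ρ 2 * ρ 3) + f (ρ 2 + ρ 4) (ρ 2 * ρ 4) + f (ρ 2 + ρ 5) (ρ 2 * ρ 5) + f (ρ 3 + ρ 4) (ρ 3
        * ρ 4) + f (ρ 3 + ρ 5) (ρ 3 * ρ 5) + f (ρ 4 + ρ 5) (ρ 4 * ρ 5) := by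
    simp only [Fin.sum_univ_castSucc, Fin.sum_univ_zero, zero_add]
    rfl
  have m_0_1 : ∑ e : Fin 15, pairProd ρ e = (1 * (∑ i, ρ i ^ 1) * (∑ i, ρ i ^ 1) - 1 * (∑ i, ρ i
    ^ 2)) / 2 := by
    rw [expand (fun u v ↦ v)]
    simp only [Fin.sum_univ_six]
    ring
  rw [p1, p2] at m_0_1
  have m_0_2 : ∑ e : Fin 15, pairProd ρ e ^ 2 = (1 * (∑ i, ρ i ^ 2) * (∑ i, ρ i ^ 2) - 1 * (∑ i,
    ρ i ^ 4)) / 2 := by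
    rw [expand (fun u v ↦ v ^ 2)]
    simp only [Fin.sum_univ_six]
    ring
  rw [p2, p4] at m_0_2
  have m_0_3 : ∑ e : Fin 15, pairProd ρ e ^ 3 = (1 * (∑ i, ρ i ^ 3) * (∑ i, ρ i ^ 3) - 1 * (∑ i,
    ρ i ^ 6)) / 2 := by
    rw [expand (fun u v ↦ v ^ 3)]
    simp only [Fin.sum_univ_six]
    ring
  rw [p3, p6] at m_0_3
  have m_0_4 : ∑ e : Fin 15, pairProd ρ e ^ 4 = (1 * (∑ i, ρ i ^ 4) * (∑ i, ρ i ^ 4) - 1 * (∑ i,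
    ρ i ^ 8)) / 2 := by
    rw [expand (fun u v ↦ v ^ 4)]
    simp only [Fin.sum_univ_six]
    ring
  rw [p4, p8] at m_0_4
  have m_1_0 : ∑ e : Fin 15, pairSum ρ e = (2 * (6 : K) * (∑ i, ρ i ^ 1) - 2 * (∑ i, ρ i ^ 1)) /
    2 := by
    rw [expand (fun u v ↦ u)]
    simp only [Fin.sum_univ_six]
    ring
  rw [p1] at m_1_0
  have m_1_1 : ∑ e : Fin 15, pairSum ρ e * pairProd ρ e = (2 * (∑ i, ρ i ^ 1) * (∑ i, ρ i ^ 2) -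
    2 * (∑ i, ρ i ^ 3)) / 2 := by
    rw [expand (fun u v ↦ u * v)]
    simp only [Fin.sum_univ_six]
    ring
  rw [p1, p2, p3] at m_1_1
  have m_1_2 : ∑ e : Fin 15, pairSum ρ e * pairProd ρ e ^ 2 = (2 * (∑ i, ρ i ^ 2) * (∑ i, ρ i ^
    3) - 2 * (∑ i, ρ i ^ 5)) / 2 := by
    rw [expand (fun u v ↦ u * v ^ 2)]
    simp only [Fin.sum_univ_six]
    ring
  rw [p2, p3, p5] at m_1_2
  have m_1_3 : ∑ e : Fin 15, pairSum ρ e * pairProd ρ e ^ 3 = (2 * (∑ i, ρ i ^ 3) * (∑ i, ρ i ^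
    4) - 2 * (∑ i, ρ i ^ 7)) / 2 := by
    rw [expand (fun u v ↦ u * v ^ 3)]
    simp only [Fin.sum_univ_six]
    ring
  rw [p3, p4, p7] at m_1_3
  have m_2_0 : ∑ e : Fin 15, pairSum ρ e ^ 2 = (2 * (6 : K) * (∑ i, ρ i ^ 2) + 2 * (∑ i, ρ i ^
    1) * (∑ i, ρ i ^ 1) - 4 * (∑ i, ρ i ^ 2)) / 2 := by
    rw [expand (fun u v ↦ u ^ 2)]
    simp only [Fin.sum_univ_six]
    ring
  rw [p1, p2] at m_2_0
  have m_2_1 : ∑ e : Fin 15, pairSum ρ e ^ 2 * pairProd ρ e = (2 * (∑ i, ρ i ^ 1) * (∑ i, ρ i ^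
    3) + 2 * (∑ i, ρ i ^ 2) * (∑ i, ρ i ^ 2) - 4 * (∑ i, ρ i ^ 4)) / 2 := by
    rw [expand (fun u v ↦ u ^ 2 * v)]
    simp only [Fin.sum_univ_six]
    ring
  rw [p1, p2, p3, p4] at m_2_1
  have m_2_2 : ∑ e : Fin 15, pairSum ρ e ^ 2 * pairProd ρ e ^ 2 = (2 * (∑ i, ρ i ^ 2) * (∑ i, ρ
    i ^ 4) + 2 * (∑ i, ρ i ^ 3) * (∑ i, ρ i ^ 3) - 4 * (∑ i, ρ i ^ 6)) / 2 := by
    rw [expand (fun u v ↦ u ^ 2 * v ^ 2)]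
    simp only [Fin.sum_univ_six]
    ring
  rw [p2, p3, p4, p6] at m_2_2
  have m_3_0 : ∑ e : Fin 15, pairSum ρ e ^ 3 = (2 * (6 : K) * (∑ i, ρ i ^ 3) + 6 * (∑ i, ρ i ^
    1) * (∑ i, ρ i ^ 2) - 8 * (∑ i, ρ i ^ 3)) / 2 := by
    rw [expand (fun u v ↦ u ^ 3)]
    simp only [Fin.sum_univ_six]
    ring
  rw [p1, p2, p3] at m_3_0
  have m_3_1 : ∑ e : Fin 15, pairSum ρ e ^ 3 * pairProd ρ e = (2 * (∑ i, ρ i ^ 1) * (∑ i, ρ i ^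
    4) + 6 * (∑ i, ρ i ^ 2) * (∑ i, ρ i ^ 3) - 8 * (∑ i, ρ i ^ 5)) / 2 := by
    rw [expand (fun u v ↦ u ^ 3 * v)]
    simp only [Fin.sum_univ_six]
    ring
  rw [p1, p2, p3, p4, p5] at m_3_1
  have m_4_0 : ∑ e : Fin 15, pairSum ρ e ^ 4 = (2 * (6 : K) * (∑ i, ρ i ^ 4) + 8 * (∑ i, ρ i ^
    1) * (∑ i, ρ i ^ 3) + 6 * (∑ i, ρ i ^ 2) * (∑ i, ρ i ^ 2) - 16 * (∑ i, ρ i ^ 4)) / 2 := by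
    rw [expand (fun u v ↦ u ^ 4)]
    simp only [Fin.sum_univ_six]
    ring
  rw [p1, p2, p3, p4] at m_4_0
  constructor
  · simp
  · rw [m_0_1]; ring
  · rw [m_0_2]; ring
  · rw [m_0_3]; ring
  · rw [m_0_4]; ring
  · rw [m_1_0]; ring
  · rw [m_1_1]; ring
  · rw [m_1_2]; ring
  · rw [m_1_3]; ring
  · rw [m_2_0]; ring
  · rw [m_2_1]; ring
  · rw [m_2_2]; ring
  · rw [m_3_0]; ring
  · rw [m_3_1]; ring
  · rw [m_4_0]; ring

theorem matchingPowerSums {ρ : Fin 6 → K} {s : K}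
    (h : (X ^ 6 + 4 * X ^ 5 - C s * X + C s : K[X]) = ∏ i, (X - C (ρ i))) :
    MatchingPowerSums (fun k ↦ ∑ m, matchingValue ρ m ^ k) s := by
  have key := sum_of_triplePowerSums (triplePowerSums_matchingValue h) (pairMoments h)
  have h3 : (3 : K) ≠ 0 := by norm_num
  have hsum (k : ℕ) := sum_matchings_through_pairs (fun m ↦ matchingValue ρ m ^ k)
  simp only [hsum, mul_right_inj' h3] at key
  obtain ⟨h1, h2, h3, h4, h5, h6, h7, h8, h9, h10, h11, h12, h13, h14, h15⟩ := key
  exact ⟨h1, h2, h3, h4, h5, h6, h7, h8, h9, h10, h11, h12, h13, h14, h15⟩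

theorem prod_X_sub_C_of_power_sums {w : Fin 15 → K} {s : K}
    (h : MatchingPowerSums (fun k ↦ ∑ m, w m ^ k) s) :
    ∏ m, (X - C (w m)) =
      X ^ 15 + C (-70 * s) * X ^ 12 + C (-320 * s) * X ^ 11 + C (-21 * s ^ 2 - 768 * s) * X ^ 10
        + C (1425 * s ^ 2) * X ^ 9 + C (11600 * s ^ 2) * X ^ 8 + C (480 * s ^ 3 + 48640 * s ^ 2)
        * X ^ 7 + C (-9520 * s ^ 3 + 163840 * s ^ 2) * X ^ 6 + C (-353 * s ^ 4 - 89248 * s ^ 3 +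
        196608 * s ^ 2) * X ^ 5 + C (-5600 * s ^ 4 - 396800 * s ^ 3) * X ^ 4 + C (-11200 * s ^ 4
        - 1433600 * s ^ 3) * X ^ 3 + C (1320 * s ^ 5 + 107520 * s ^ 4 - 7864320 * s ^ 3) * X ^ 2
        + C (14320 * s ^ 5 - 346880 * s ^ 4 - 20971520 * s ^ 3) * X + C (32 * s ^ 6 + 26368 * s
        ^ 5 - 1888256 * s ^ 4 - 16777216 * s ^ 3) := by
  have e0 : (Finset.univ.val.map w).esymm 0 = 1 := by simp [Multiset.esymm]
  have e1 : (Finset.univ.val.map w).esymm 1 = 0 := by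
    have hk := newton_recurrence w 0
    simp only [Finset.sum_range_succ, Finset.sum_range_zero, Nat.reduceAdd, Nat.reduceSub,
      e0,
      h.psum_1] at hk
    push_cast at hk
    linear_combination hk / 1
  have e2 : (Finset.univ.val.map w).esymm 2 = 0 := by
    have hk := newton_recurrence w 1
    simp only [Finset.sum_range_succ, Finset.sum_range_zero, Nat.reduceAdd, Nat.reduceSub,
      e0, e1,
      h.psum_1, h.psum_2] at hk
    push_cast at hk
    linear_combination hk / 2
  have e3 : (Finset.univ.val.map w).esymm 3 = 70 * s := by
    have hk := newton_recurrence w 2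
    simp only [Finset.sum_range_succ, Finset.sum_range_zero, Nat.reduceAdd, Nat.reduceSub,
      e0, e1, e2,
      h.psum_1, h.psum_2, h.psum_3] at hk
    push_cast at hk
    linear_combination hk / 3
  have e4 : (Finset.univ.val.map w).esymm 4 = -320 * s := by
    have hk := newton_recurrence w 3
    simp only [Finset.sum_range_succ, Finset.sum_range_zero, Nat.reduceAdd, Nat.reduceSub,
      e0, e1, e2, e3,
      h.psum_1, h.psum_2, h.psum_3, h.psum_4] at hk
    push_cast at hk
    linear_combination hk / 4
  have e5 : (Finset.univ.val.map w).esymm 5 = 21 * s ^ 2 + 768 * s := by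
    have hk := newton_recurrence w 4
    simp only [Finset.sum_range_succ, Finset.sum_range_zero, Nat.reduceAdd, Nat.reduceSub,
      e0, e1, e2, e3, e4,
      h.psum_1, h.psum_2, h.psum_3, h.psum_4, h.psum_5] at hk
    push_cast at hk
    linear_combination hk / 5
  have e6 : (Finset.univ.val.map w).esymm 6 = 1425 * s ^ 2 := by
    have hk := newton_recurrence w 5
    simp only [Finset.sum_range_succ, Finset.sum_range_zero, Nat.reduceAdd, Nat.reduceSub,
      e0, e1, e2, e3, e4, e5,
      h.psum_1, h.psum_2, h.psum_3, h.psum_4, h.psum_5, h.psum_6] at hk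
    push_cast at hk
    linear_combination hk / 6
  have e7 : (Finset.univ.val.map w).esymm 7 = -11600 * s ^ 2 := by
    have hk := newton_recurrence w 6
    simp only [Finset.sum_range_succ, Finset.sum_range_zero, Nat.reduceAdd, Nat.reduceSub,
      e0, e1, e2, e3, e4, e5, e6,
      h.psum_1, h.psum_2, h.psum_3, h.psum_4, h.psum_5, h.psum_6, h.psum_7] at hk
    push_cast at hk
    linear_combination hk / 7
  have e8 : (Finset.univ.val.map w).esymm 8 = 480 * s ^ 3 + 48640 * s ^ 2 := by
    have hk := newton_recurrence w 7
    simp only [Finset.sum_range_succ, Finset.sum_range_zero, Nat.reduceAdd, Nat.reduceSub,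
      e0, e1, e2, e3, e4, e5, e6, e7,
      h.psum_1, h.psum_2, h.psum_3, h.psum_4, h.psum_5, h.psum_6, h.psum_7, h.psum_8] at hk
    push_cast at hk
    linear_combination hk / 8
  have e9 : (Finset.univ.val.map w).esymm 9 = 9520 * s ^ 3 - 163840 * s ^ 2 := by
    have hk := newton_recurrence w 8
    simp only [Finset.sum_range_succ, Finset.sum_range_zero, Nat.reduceAdd, Nat.reduceSub,
      e0, e1, e2, e3, e4, e5, e6, e7, e8,
      h.psum_1, h.psum_2, h.psum_3, h.psum_4, h.psum_5, h.psum_6, h.psum_7, h.psum_8, h.psum_9] at hk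
    push_cast at hk
    linear_combination hk / 9
  have e10 : (Finset.univ.val.map w).esymm 10 = -353 * s ^ 4 - 89248 * s ^ 3 + 196608 * s ^ 2 := by
    have hk := newton_recurrence w 9
    simp only [Finset.sum_range_succ, Finset.sum_range_zero, Nat.reduceAdd, Nat.reduceSub,
      e0, e1, e2, e3, e4, e5, e6, e7, e8, e9,
      h.psum_1, h.psum_2, h.psum_3, h.psum_4, h.psum_5, h.psum_6, h.psum_7, h.psum_8, h.psum_9, h.psum_10] at hk
    push_cast at hk
    linear_combination hk / 10
  have e11 : (Finset.univ.val.map w).esymm 11 = 5600 * s ^ 4 + 396800 * s ^ 3 := by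
    have hk := newton_recurrence w 10
    simp only [Finset.sum_range_succ, Finset.sum_range_zero, Nat.reduceAdd, Nat.reduceSub,
      e0, e1, e2, e3, e4, e5, e6, e7, e8, e9, e10,
      h.psum_1, h.psum_2, h.psum_3, h.psum_4, h.psum_5, h.psum_6, h.psum_7, h.psum_8, h.psum_9, h.psum_10, h.psum_11] at hk
    push_cast at hk
    linear_combination hk / 11
  have e12 : (Finset.univ.val.map w).esymm 12 = -11200 * s ^ 4 - 1433600 * s ^ 3 := by
    have hk := newton_recurrence w 11
    simp only [Finset.sum_range_succ, Finset.sum_range_zero, Nat.reduceAdd, Nat.reduceSub,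
      e0, e1, e2, e3, e4, e5, e6, e7, e8, e9, e10, e11,
      h.psum_1, h.psum_2, h.psum_3, h.psum_4, h.psum_5, h.psum_6, h.psum_7, h.psum_8, h.psum_9, h.psum_10, h.psum_11, h.psum_12] at hk
    push_cast at hk
    linear_combination hk / 12
  have e13 : (Finset.univ.val.map w).esymm 13 = -1320 * s ^ 5 - 107520 * s ^ 4 + 7864320 * s ^ 3 := by
    have hk := newton_recurrence w 12
    simp only [Finset.sum_range_succ, Finset.sum_range_zero, Nat.reduceAdd, Nat.reduceSub,
      e0, e1, e2, e3, e4, e5, e6, e7, e8, e9, e10, e11, e12,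
      h.psum_1, h.psum_2, h.psum_3, h.psum_4, h.psum_5, h.psum_6, h.psum_7, h.psum_8, h.psum_9, h.psum_10, h.psum_11, h.psum_12, h.psum_13] at hk
    push_cast at hk
    linear_combination hk / 13
  have e14 : (Finset.univ.val.map w).esymm 14 = 14320 * s ^ 5 - 346880 * s ^ 4 - 20971520 * s ^ 3 := by
    have hk := newton_recurrence w 13
    simp only [Finset.sum_range_succ, Finset.sum_range_zero, Nat.reduceAdd, Nat.reduceSub,
      e0, e1, e2, e3, e4, e5, e6, e7, e8, e9, e10, e11, e12, e13,
      h.psum_1, h.psum_2, h.psum_3, h.psum_4, h.psum_5, h.psum_6, h.psum_7, h.psum_8, h.psum_9, h.psum_10, h.psum_11, h.psum_12, h.psum_13, h.psum_14] at hk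
    push_cast at hk
    linear_combination hk / 14
  have e15 : (Finset.univ.val.map w).esymm 15 = -32 * s ^ 6 - 26368 * s ^ 5 + 1888256 * s ^ 4 + 16777216 * s ^ 3 := by
    have hk := newton_recurrence w 14
    simp only [Finset.sum_range_succ, Finset.sum_range_zero, Nat.reduceAdd, Nat.reduceSub,
      e0, e1, e2, e3, e4, e5, e6, e7, e8, e9, e10, e11, e12, e13, e14,
      h.psum_1, h.psum_2, h.psum_3, h.psum_4, h.psum_5, h.psum_6, h.psum_7, h.psum_8, h.psum_9, h.psum_10, h.psum_11, h.psum_12, h.psum_13, h.psum_14, h.psum_15] at hk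
    push_cast at hk
    linear_combination hk / 15
  have hprod : ∏ m, (X - C (w m)) =
      ((Finset.univ.val.map w).map fun x ↦ X - C x).prod := by
    rw [Multiset.map_map]; rfl
  rw [hprod, Multiset.prod_X_sub_X_eq_sum_esymm]
  simp only [Multiset.card_map, Finset.card_val, Finset.card_univ, Fintype.card_fin,
    Finset.sum_range_succ, Finset.sum_range_zero, Nat.reduceAdd, Nat.reduceSub,
    e0, e1, e2, e3, e4, e5, e6, e7, e8, e9, e10, e11, e12, e13, e14, e15]
  simp only [map_neg, map_zero, map_one, map_add, map_sub, map_mul, map_pow]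
  ring

end MatchingPowerSums

section Irreducibility

theorem irreducible_map_quintic_factor :
    Irreducible ((X ^ 5 - C (2560 * X) * X ^ 2 - C (131072 * X ^ 2) - C (15360 * X) * X
      - C (16384 * X) : ℂ[X][X]).map (algebraMap ℂ[X] (RatFunc ℂ))) := by
  set A : ℂ[X][X] := X ^ 5 - C (2560 * X) * X ^ 2 - C (131072 * X ^ 2) - C (15360 * X) * X
      - C (16384 * X) with hA
  have hdeg : A.natDegree = 5 := by rw [hA]; compute_degree!
  have hdeg' : A.degree = 5 := by rw [hA]; compute_degree!
  have hmonic : A.Monic := by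
    rw [Monic, leadingCoeff, hdeg, hA]
    simp [-map_mul, -map_pow]
  have hc0 : A.coeff 0 = -(131072 * X ^ 2) - 16384 * X := by
    rw [hA]; simp [-map_mul, -map_pow]
  rw [← hmonic.irreducible_iff_irreducible_map_fraction_map]
  refine irreducible_of_eisenstein_criterion (P := Ideal.span {(X : ℂ[X])})
    ((Ideal.span_singleton_prime X_ne_zero).2 prime_X) ?_ ?_ ?_ ?_ hmonic.isPrimitive
  · rw [hmonic.leadingCoeff, Ideal.mem_span_singleton, X_dvd_iff]
    simp
  · intro n hn
    rw [hdeg'] at hn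
    have hn : n < 5 := by exact_mod_cast hn
    rw [Ideal.mem_span_singleton, X_dvd_iff, hA]
    interval_cases n <;> simp [coeff_X, coeff_C, -map_mul, -map_pow]
  · rw [hdeg']; norm_num
  · rw [hc0, Ideal.span_singleton_pow, Ideal.mem_span_singleton, X_pow_dvd_iff]
    intro h
    have := h 1 (by norm_num)
    rw [← C_ofNat, ← C_ofNat] at this
    simp [coeff_X_pow] at this

/-- The substitution `t ↦ z⁵`, `x ↦ y z²`, which turns the weight `5 a + 2 b` of a monomial
`tᵃ xᵇ` into the degree in `z`. -/
noncomputable def weightHom : ℂ[X][X] →+* ℂ[X][X] :=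
  eval₂RingHom (eval₂RingHom (C.comp C) (X ^ 5)) (C X * X ^ 2)

theorem coeff_coeff_weightHom (F : ℂ[X][X]) (a b : ℕ) :
    ((weightHom F).coeff (5 * a + 2 * b)).coeff b = (F.coeff b).coeff a := by
  induction F using Polynomial.induction_on' with
  | add p q hp hq => simp [hp, hq]
  | monomial n p =>
    induction p using Polynomial.induction_on' with
    | add p q hp hq => simp [hp, hq]
    | monomial k c =>
      have : weightHom (monomial n (monomial k c)) = monomial (5 * k + 2 * n) (monomial n c) := by
        simp only [weightHom, coe_eval₂RingHom, eval₂_monomial, RingHom.comp_apply]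
        simp only [← C_mul_X_pow_eq_monomial, C_mul, C_pow]
        ring
      rw [this]
      by_cases hn : n = b
      · subst hn
        by_cases hk : k = a
        · simp [hk]
        · simp [coeff_monomial, hk]
      · simp only [coeff_monomial, hn, if_false]
        split_ifs <;> simp [coeff_monomial, hn]

theorem two_mul_natDegree_le_weight {F : ℂ[X][X]} (hF : F.Monic) :
    2 * F.natDegree ≤ (weightHom F).natDegree := by
  refine le_natDegree_of_ne_zero fun h ↦ ?_
  have := coeff_coeff_weightHom F 0 F.natDegree
  rw [mul_zero, zero_add, h, coeff_natDegree, hF.leadingCoeff] at this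
  simp at this

theorem weight_le_of_mul {F G : ℂ[X][X]} (hF : F.Monic) (hG : G.Monic)
    (h : (weightHom (F * G)).natDegree ≤ 2 * (F * G).natDegree) {a b : ℕ}
    (hab : (F.coeff b).coeff a ≠ 0) : 5 * a + 2 * b ≤ 2 * F.natDegree := by
  have hne : ∀ {P : ℂ[X][X]}, P.Monic → weightHom P ≠ 0 := fun {P} hP h0 ↦ by
    have := coeff_coeff_weightHom P 0 P.natDegree
    rw [h0, coeff_natDegree, hP.leadingCoeff] at this
    simp at this
  rw [map_mul, natDegree_mul (hne hF) (hne hG), hF.natDegree_mul hG] at h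
  have h1 := two_mul_natDegree_le_weight hG
  have h2 : 5 * a + 2 * b ≤ (weightHom F).natDegree := by
    refine le_natDegree_of_ne_zero fun h0 ↦ hab ?_
    rw [← coeff_coeff_weightHom, h0, coeff_zero]
  omega

theorem coeff_zero_coeff_of_mul {F G : ℂ[X][X]} {n : ℕ} (hF : F.Monic)
    (h : (F * G).map (evalRingHom 0) = X ^ n) {b : ℕ} (hb : b < F.natDegree) :
    (F.coeff b).coeff 0 = 0 := by
  rw [Polynomial.map_mul] at h
  obtain ⟨i, -, hi⟩ := (dvd_prime_pow prime_X n).1 (Dvd.intro _ h)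
  have hi := eq_of_monic_of_associated (hF.map _) (monic_X_pow i) hi
  have hd := congrArg natDegree hi
  rw [hF.natDegree_map, natDegree_X_pow] at hd
  have := congrArg (fun P ↦ coeff P b) hi
  simp only [coeff_map, coeff_X_pow, coe_evalRingHom] at this
  rw [coeff_zero_eq_eval_zero, this, if_neg (by omega)]

/-- The shape of a quintic factor of the factor of degree ten. -/
theorem coeffs_of_quintic {F G : ℂ[X][X]} (hF : F.Monic) (hG : G.Monic)
    (hw : (weightHom (F * G)).natDegree ≤ 2 * (F * G).natDegree)
    (hm : (F * G).map (evalRingHom 0) = X ^ 10) (hd : F.natDegree = 5) :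
    F.coeff 5 = 1 ∧ F.coeff 4 = 0 ∧ F.coeff 3 = 0 ∧ (∃ a, F.coeff 2 = C a * X) ∧
      (∃ b, F.coeff 1 = C b * X) ∧ ∃ c d, F.coeff 0 = C c * X + C d * X ^ 2 := by
  have hz : ∀ b a, 10 < 5 * a + 2 * b → (F.coeff b).coeff a = 0 := fun b a h ↦ by
    by_contra hne
    have := weight_le_of_mul hF hG hw hne
    omega
  have h0 : ∀ b, b < 5 → (F.coeff b).coeff 0 = 0 := fun b h ↦
    coeff_zero_coeff_of_mul hF hm (hd ▸ h)
  refine ⟨hd ▸ hF.coeff_natDegree, ?_, ?_, ⟨(F.coeff 2).coeff 1, ?_⟩, ⟨(F.coeff 1).coeff 1, ?_⟩,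
    (F.coeff 0).coeff 1, (F.coeff 0).coeff 2, ?_⟩
  · ext (_ | a)
    · exact h0 4 (by norm_num)
    · exact hz 4 _ (by omega)
  · ext (_ | a)
    · exact h0 3 (by norm_num)
    · exact hz 3 _ (by omega)
  · ext (_ | _ | a)
    · simpa using h0 2 (by norm_num)
    · simp
    · simpa [coeff_X] using hz 2 (a + 2) (by omega)
  · ext (_ | _ | a)
    · simpa using h0 1 (by norm_num)
    · simp
    · simpa [coeff_X] using hz 1 (a + 2) (by omega)
  · ext (_ | _ | _ | a)
    · simpa using h0 0 (by norm_num)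
    · simp [coeff_X_pow]
    · simp
    · simpa [coeff_X, coeff_X_pow] using hz 0 (a + 3) (by omega)

set_option maxHeartbeats 4000000 in
theorem irreducible_map_decic_factor :
    Irreducible ((X ^ 10 - C (1920 * X) * X ^ 7 + C (45056 * X ^ 2) * X ^ 5
      - C (5120 * X) * X ^ 6 + C (921600 * X ^ 2) * X ^ 4
      - C (32768 * X) * X ^ 5 - C (10485760 * X ^ 3) * X ^ 2
      + C (4915200 * X ^ 2) * X ^ 3 - C (16777216 * X ^ 4)
      - C (115343360 * X ^ 3) * X + C (5242880 * X ^ 2) * X ^ 2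
      - C (213909504 * X ^ 3) + C (83886080 * X ^ 2) * X
      + C (268435456 * X ^ 2) : ℂ[X][X]).map (algebraMap ℂ[X] (RatFunc ℂ))) := by
  set B : ℂ[X][X] := X ^ 10 - C (1920 * X) * X ^ 7 + C (45056 * X ^ 2) * X ^ 5
      - C (5120 * X) * X ^ 6 + C (921600 * X ^ 2) * X ^ 4
      - C (32768 * X) * X ^ 5 - C (10485760 * X ^ 3) * X ^ 2
      + C (4915200 * X ^ 2) * X ^ 3 - C (16777216 * X ^ 4)
      - C (115343360 * X ^ 3) * X + C (5242880 * X ^ 2) * X ^ 2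
      - C (213909504 * X ^ 3) + C (83886080 * X ^ 2) * X
      + C (268435456 * X ^ 2) with hB
  have hdeg : B.natDegree = 10 := by rw [hB]; compute_degree!
  have hmonic : B.Monic := by
    rw [Monic, leadingCoeff, hdeg, hB]
    simp [-map_mul, -map_pow]
  have hc0 : B.coeff 0 = C (-16777216) * X ^ 4 + C (-213909504) * X ^ 3 + C 268435456 * X ^ 2 := by
    rw [hB]
    simp [-map_mul, -map_pow]
    simp only [map_ofNat]
    ring
  have hc2 : B.coeff 2 = C (-10485760) * X ^ 3 + C 5242880 * X ^ 2 := by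
    rw [hB]; simp [-map_mul, -map_pow]
    simp only [map_ofNat]
  have hc4 : B.coeff 4 = C 921600 * X ^ 2 := by
    rw [hB]; simp [-map_mul, -map_pow]
    simp only [map_ofNat]
  have hc5 : B.coeff 5 = C 45056 * X ^ 2 + C (-32768) * X := by
    rw [hB]; simp [-map_mul, -map_pow]
    simp only [map_ofNat]
    ring
  have hc7 : B.coeff 7 = C (-1920) * X := by
    rw [hB]; simp [-map_mul, -map_pow]
    simp only [map_ofNat]
  have hc0deg : (B.coeff 0).natDegree = 4 := by
    rw [hc0]; compute_degree!
  have hw : (weightHom B).natDegree ≤ 2 * B.natDegree := by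
    rw [hdeg, hB]
    simp only [weightHom, map_add, map_sub, map_mul, map_pow, map_ofNat, coe_eval₂RingHom,
      eval₂_X, eval₂_C]
    compute_degree
  have hm : B.map (evalRingHom 0) = X ^ 10 := by
    rw [hB]
    simp
  rw [← hmonic.irreducible_iff_irreducible_map_fraction_map, hmonic.irreducible_iff_natDegree]
  refine ⟨fun h ↦ by simp [h] at hdeg, fun F G hF hG hFG ↦ ?_⟩
  have hFG' : G * F = B := by rw [mul_comm, hFG]
  have hsum : F.natDegree + G.natDegree = 10 := by rw [← hF.natDegree_mul hG, hFG, hdeg]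
  have hmul0 : F.coeff 0 * G.coeff 0 = B.coeff 0 := by rw [← hFG, mul_coeff_zero]
  have hne : F.coeff 0 * G.coeff 0 ≠ 0 := fun h ↦ by
    rw [← hmul0, h] at hc0deg
    simp at hc0deg
  have hlow : 5 * (F.coeff 0).natDegree ≤ 2 * F.natDegree :=
    weight_le_of_mul (b := 0) hF hG (hFG ▸ hw) (leadingCoeff_ne_zero.2 (left_ne_zero_of_mul hne))
  have hlow' : 5 * (G.coeff 0).natDegree ≤ 2 * G.natDegree :=
    weight_le_of_mul (b := 0) hG hF (hFG' ▸ hw) (leadingCoeff_ne_zero.2 (right_ne_zero_of_mul hne))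
  have hsum0 : (F.coeff 0).natDegree + (G.coeff 0).natDegree = 4 := by
    rw [← natDegree_mul (left_ne_zero_of_mul hne) (right_ne_zero_of_mul hne), hmul0, hc0deg]
  by_contra! hpos
  have hF5 : F.natDegree = 5 := by omega
  have hG5 : G.natDegree = 5 := by omega
  obtain ⟨f5, f4, f3, ⟨a, f2⟩, ⟨b, f1⟩, c, d, f0⟩ :=
    coeffs_of_quintic hF hG (hFG ▸ hw) (hFG ▸ hm) hF5
  obtain ⟨g5, g4, g3, ⟨a', g2⟩, ⟨b', g1⟩, c', d', g0⟩ :=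
    coeffs_of_quintic hG hF (hFG' ▸ hw) (hFG' ▸ hm) hG5
  have fz : ∀ n, 5 < n → F.coeff n = 0 := fun n hn ↦ coeff_eq_zero_of_natDegree_lt (hF5 ▸ hn)
  have gz : ∀ n, 5 < n → G.coeff n = 0 := fun n hn ↦ coeff_eq_zero_of_natDegree_lt (hG5 ▸ hn)
  have e7 : C (a + a') * X = C (-1920) * X := by
    rw [← hc7, ← hFG, coeff_mul, Finset.Nat.sum_antidiagonal_eq_sum_range_succ_mk]
    simp only [Finset.sum_range_succ, Finset.sum_range_zero, Nat.reduceSub, f0, f1, f2, f3, f4, f5,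
      g0, g1, g2, g3, g4, g5, fz 6 (by norm_num), fz 7 (by norm_num), gz 6 (by norm_num),
      gz 7 (by norm_num), map_add]
    ring
  have e5 : C (d + d') * X ^ 2 + C (c + c') * X = C 45056 * X ^ 2 + C (-32768) * X := by
    rw [← hc5, ← hFG, coeff_mul, Finset.Nat.sum_antidiagonal_eq_sum_range_succ_mk]
    simp only [Finset.sum_range_succ, Finset.sum_range_zero, Nat.reduceSub, f0, f1, f2, f3, f4, f5,
      g0, g1, g2, g3, g4, g5, map_add]
    ring
  have e4 : C (a * a') * X ^ 2 = C 921600 * X ^ 2 := by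
    rw [← hc4, ← hFG, coeff_mul, Finset.Nat.sum_antidiagonal_eq_sum_range_succ_mk]
    simp only [Finset.sum_range_succ, Finset.sum_range_zero, Nat.reduceSub, f0, f1, f2, f3, f4,
      g0, g1, g2, g3, g4, map_mul]
    ring
  have e2 : C (a * d' + a' * d) * X ^ 3 + C (a * c' + b * b' + a' * c) * X ^ 2 =
      C (-10485760) * X ^ 3 + C 5242880 * X ^ 2 := by
    rw [← hc2, ← hFG, coeff_mul, Finset.Nat.sum_antidiagonal_eq_sum_range_succ_mk]
    simp only [Finset.sum_range_succ, Finset.sum_range_zero, Nat.reduceSub, f0, f1, f2,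
      g0, g1, g2, map_mul, map_add]
    ring
  have q7 : a + a' = -1920 := by simpa only [coeff_C_mul_X, if_true] using congrArg (coeff · 1) e7
  have q4 : a * a' = 921600 := by
    simpa only [coeff_C_mul_X_pow, if_true] using congrArg (coeff · 2) e4
  have q5 : d + d' = 45056 := by
    have := congrArg (coeff · 2) e5
    simpa only [coeff_add, coeff_C_mul_X_pow, coeff_C_mul_X, if_true, OfNat.ofNat_ne_one, if_false,
      add_zero] using this
  have q2 : a * d' + a' * d = -10485760 := by
    have := congrArg (coeff · 3) e2
    simpa [coeff_C_mul_X_pow, -map_add, -map_mul] using this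
  have ha : a = -960 := by
    have : (a + 960) ^ 2 = 0 := by linear_combination a * q7 - q4
    linear_combination pow_eq_zero_iff (two_ne_zero) |>.1 this
  have ha' : a' = -960 := by linear_combination q7 - ha
  rw [ha, ha'] at q2
  have : (32768000 : ℂ) = 0 := by linear_combination -q2 - 960 * q5
  norm_num at this

end Irreducibility

/-- The degree-15 resolvent `f₁₅(x) = ∏_{ω ∈ Ω}(x − ω)`, where `Ω` is the set
of the 15 expressions `ρ_aρ_b + ρ_cρ_d + ρ_eρ_f` (one for each perfect
matching of the six roots `ρ₁,…,ρ₆` of `w⁶ + 4w⁵ − 64tw + 64t` over `ℂ(t)`),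
factors over `ℂ(t)` as the product of an irreducible polynomial of degree 5
and an irreducible polynomial of degree 10, given explicitly below. -/
theorem genus19_resolvent_factorization
    (L : Type*) [Field L] [Algebra (RatFunc ℂ) L] (ρ : Fin 6 → L)
    (hsplit :
      (X ^ 6 + 4 * X ^ 5
          - C (algebraMap (RatFunc ℂ) L (64 * RatFunc.X)) * X
          + C (algebraMap (RatFunc ℂ) L (64 * RatFunc.X)) : Polynomial L)
        = ∏ i : Fin 6, (X - C (ρ i))) :
    let t : RatFunc ℂ := RatFunc.X
    let A : Polynomial (RatFunc ℂ) :=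
      X ^ 5 - C (2560 * t) * X ^ 2 - C (131072 * t ^ 2) - C (15360 * t) * X
        - C (16384 * t)
    let B : Polynomial (RatFunc ℂ) :=
      X ^ 10 - C (1920 * t) * X ^ 7 + C (45056 * t ^ 2) * X ^ 5
        - C (5120 * t) * X ^ 6 + C (921600 * t ^ 2) * X ^ 4
        - C (32768 * t) * X ^ 5 - C (10485760 * t ^ 3) * X ^ 2
        + C (4915200 * t ^ 2) * X ^ 3 - C (16777216 * t ^ 4)
        - C (115343360 * t ^ 3) * X + C (5242880 * t ^ 2) * X ^ 2
        - C (213909504 * t ^ 3) + C (83886080 * t ^ 2) * X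
        + C (268435456 * t ^ 2)
    ((X - C (ρ 0 * ρ 1 + ρ 2 * ρ 3 + ρ 4 * ρ 5)) *
     (X - C (ρ 0 * ρ 1 + ρ 2 * ρ 4 + ρ 3 * ρ 5)) *
     (X - C (ρ 0 * ρ 1 + ρ 2 * ρ 5 + ρ 3 * ρ 4)) *
     (X - C (ρ 0 * ρ 2 + ρ 1 * ρ 3 + ρ 4 * ρ 5)) *
     (X - C (ρ 0 * ρ 2 + ρ 1 * ρ 4 + ρ 3 * ρ 5)) *
     (X - C (ρ 0 * ρ 2 + ρ 1 * ρ 5 + ρ 3 * ρ 4)) *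
     (X - C (ρ 0 * ρ 3 + ρ 1 * ρ 2 + ρ 4 * ρ 5)) *
     (X - C (ρ 0 * ρ 3 + ρ 1 * ρ 4 + ρ 2 * ρ 5)) *
     (X - C (ρ 0 * ρ 3 + ρ 1 * ρ 5 + ρ 2 * ρ 4)) *
     (X - C (ρ 0 * ρ 4 + ρ 1 * ρ 2 + ρ 3 * ρ 5)) *
     (X - C (ρ 0 * ρ 4 + ρ 1 * ρ 3 + ρ 2 * ρ 5)) *
     (X - C (ρ 0 * ρ 4 + ρ 1 * ρ 5 + ρ 2 * ρ 3)) *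
     (X - C (ρ 0 * ρ 5 + ρ 1 * ρ 2 + ρ 3 * ρ 4)) *
     (X - C (ρ 0 * ρ 5 + ρ 1 * ρ 3 + ρ 2 * ρ 4)) *
     (X - C (ρ 0 * ρ 5 + ρ 1 * ρ 4 + ρ 2 * ρ 3)) : Polynomial L)
        = (A * B).map (algebraMap (RatFunc ℂ) L) ∧
      Irreducible A ∧ Irreducible B := by
  intro t A B
  have : CharZero L := charZero_of_injective_algebraMap (algebraMap (RatFunc ℂ) L).injective
  refine ⟨?_, ?_, ?_⟩
  · have key := prod_X_sub_C_of_power_sums (matchingPowerSums hsplit)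
    simp only [Fin.prod_univ_castSucc, Fin.prod_univ_zero, one_mul] at key
    refine Eq.trans rfl (key.trans ?_)
    simp only [A, B, t, Polynomial.map_mul, Polynomial.map_add, Polynomial.map_sub,
      Polynomial.map_pow, map_X, map_C, map_mul, map_pow, Polynomial.map_ofNat, map_ofNat,
      map_add, map_sub, map_neg]
    ring
  · convert irreducible_map_quintic_factor using 1
    simp only [A, t, Polynomial.map_sub, Polynomial.map_mul,
      Polynomial.map_pow, map_X, map_C, map_mul, map_pow, Polynomial.map_ofNat, map_ofNat,
      RatFunc.algebraMap_X]
  · convert irreducible_map_decic_factor using 1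
    simp only [B, t, Polynomial.map_add, Polynomial.map_sub, Polynomial.map_mul,
      Polynomial.map_pow, map_X, map_C, map_mul, map_pow, Polynomial.map_ofNat, map_ofNat,
      RatFunc.algebraMap_X]
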